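/- arXiv:1305.4818 — 5 statements merged into one kernel-verified Lean document; each statement's English description precedes it below -/
import Mathlib

section
/- For every z ∈ ℂ with z ∉ (-∞,0], the derivative at ν = 1/2 of the map ν ↦ I_ν(z) equals −(1/√(2πz)) · (Ei(2z)·e^{−z} + E₁(2z)·e^{z}), where the square root is the principal branch. -/
open Complex

/-- The modified Bessel function of the first kind
`I_ν(z) = (z/2)^ν ∑_{k≥0} (z²/4)^k / (k! Γ(ν+k+1))`, with the principal power. -/
noncomputable def besselI (ν z : ℂ) : ℂ :=
  (z / 2) ^ ν * ∑' k : ℕ, (z ^ 2 / 4) ^ k / ((k.factorial : ℂ) * Complex.Gamma (ν + k + 1))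

/-- The exponential integral `Ei(z) = γ + Log z + ∑_{n≥1} zⁿ/(n·n!)`. -/
noncomputable def expIntEi (z : ℂ) : ℂ :=
  (Real.eulerMascheroniConstant : ℂ) + Complex.log z +
    ∑' n : ℕ, z ^ (n + 1) / (((n : ℂ) + 1) * ((n + 1).factorial : ℂ))

/-- The exponential integral `E₁(z) = −γ − Log z − ∑_{n≥1} (−1)ⁿ zⁿ/(n·n!)`. -/
noncomputable def expIntE1 (z : ℂ) : ℂ :=
  -(Real.eulerMascheroniConstant : ℂ) - Complex.log z -
    ∑' n : ℕ, (-1) ^ (n + 1) * z ^ (n + 1) / (((n : ℂ) + 1) * ((n + 1).factorial : ℂ))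


/-- Coefficients of the Cauchy product. -/
noncomputable def dcoef (m : ℕ) : ℂ :=
  ∑ k ∈ Finset.range (m + 1), (m.choose k : ℂ) * (-2) ^ k / k

/-- Odd harmonic sums. -/
noncomputable def oddH (k : ℕ) : ℂ := ∑ j ∈ Finset.range (k + 1), 1 / (2 * (j : ℂ) + 1)

lemma dcoef_succ (m : ℕ) :
    dcoef (m + 1) = dcoef m + ((-1) ^ (m + 1) - 1) / ((m : ℂ) + 1) := by
  have hm : (m : ℂ) + 1 ≠ 0 := by exact_mod_cast Nat.succ_ne_zero m
  have h1 : dcoef m = ∑ k ∈ Finset.range (m + 2), (m.choose k : ℂ) * (-2) ^ k / k := by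
    rw [Finset.sum_range_succ _ (m + 1)]
    simp [dcoef]
  have hb : ((-1 : ℂ)) ^ (m + 1) - 1 =
      ∑ j ∈ Finset.range (m + 1), ((m + 1).choose (j + 1) : ℂ) * (-2) ^ (j + 1) := by
    have := add_pow (-2 : ℂ) 1 (m + 1)
    rw [Finset.sum_range_succ'] at this
    norm_num at this
    rw [this, add_sub_cancel_right]
    exact Finset.sum_congr rfl fun j _ => mul_comm _ _
  rw [hb, h1, dcoef, Finset.sum_range_succ', Finset.sum_range_succ' _ (m + 1), Finset.sum_div]
  simp only [Nat.cast_zero, div_zero, add_zero]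
  rw [← Finset.sum_add_distrib]
  refine Finset.sum_congr rfl fun j _ => ?_
  have hj : ((j + 1 : ℕ) : ℂ) ≠ 0 := by exact_mod_cast Nat.succ_ne_zero j
  have e1 : ((m + 1).choose (j + 1) : ℂ) = m.choose j + m.choose (j + 1) := by
    exact_mod_cast Nat.choose_succ_succ m j
  have e2 : ((m : ℂ) + 1) * m.choose j = (m + 1).choose (j + 1) * ((j + 1 : ℕ) : ℂ) := by
    exact_mod_cast Nat.add_one_mul_choose_eq m j
  have e3 : ((m + 1).choose (j + 1) : ℂ) / ((m : ℂ) + 1) = m.choose j / ((j + 1 : ℕ) : ℂ) := by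
    rw [div_eq_div_iff hm hj, ← e2]; ring
  rw [mul_div_right_comm _ _ ((m : ℂ) + 1), e3, e1]
  ring

lemma dcoef_odd (k : ℕ) : dcoef (2 * k + 1) = -2 * oddH k := by
  induction k with
  | zero => simp [dcoef, oddH, Finset.sum_range_succ]
  | succ k ih =>
    have h : 2 * (k + 1) + 1 = (2 * k + 1 + 1) + 1 := by ring
    have p1 : (-1 : ℂ) ^ (2 * k + 1 + 1) = 1 := Even.neg_one_pow ⟨k + 1, by ring⟩
    have p2 : (-1 : ℂ) ^ (2 * k + 1 + 1 + 1) = -1 := Odd.neg_one_pow ⟨k + 1, by ring⟩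
    have e : oddH (k + 1) = oddH k + 1 / (2 * ((k + 1 : ℕ) : ℂ) + 1) := by
      rw [oddH, Finset.sum_range_succ]; rfl
    rw [h, dcoef_succ, dcoef_succ, ih, p1, p2, e]
    push_cast
    ring

lemma hasSum_cexp (x : ℂ) : HasSum (fun n : ℕ => x ^ n / (n.factorial : ℂ)) (Complex.exp x) := by
  rw [Complex.exp_eq_exp_ℂ]
  exact NormedSpace.expSeries_div_hasSum_exp x

lemma summable_norm_exp (x : ℂ) : Summable (fun n : ℕ => ‖x ^ n / (n.factorial : ℂ)‖) := by
  exact NormedSpace.norm_expSeries_div_summable x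

lemma summable_norm_P (x : ℂ) :
    Summable (fun n : ℕ => ‖x ^ n / ((n : ℂ) * (n.factorial : ℂ))‖) := by
  refine Summable.of_nonneg_of_le (fun _ => norm_nonneg _) (fun n => ?_) (summable_norm_exp x)
  rcases Nat.eq_zero_or_pos n with rfl | hn
  · simp
  · rw [norm_div, norm_div, norm_mul]
    have h1 : (1 : ℝ) ≤ ‖(n : ℂ)‖ := by
      rw [Complex.norm_natCast]; exact_mod_cast hn
    have h2 : 0 < ‖(n.factorial : ℂ)‖ := by
      rw [Complex.norm_natCast]; exact_mod_cast n.factorial_pos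
    gcongr
    nlinarith

lemma tsum_P_shift (x : ℂ) :
    ∑' n : ℕ, x ^ (n + 1) / (((n : ℂ) + 1) * ((n + 1).factorial : ℂ)) =
      ∑' n : ℕ, x ^ n / ((n : ℂ) * (n.factorial : ℂ)) := by
  rw [(summable_norm_P x).of_norm.tsum_eq_zero_add]
  simp

lemma hasSum_PE (z : ℂ) :
    HasSum (fun m : ℕ => (-1) ^ m * dcoef m * (z ^ m / (m.factorial : ℂ)))
      ((∑' n : ℕ, (2 * z) ^ n / ((n : ℂ) * (n.factorial : ℂ))) * Complex.exp (-z)) := by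
  have h := hasSum_sum_range_mul_of_summable_norm (summable_norm_P (2 * z))
    (summable_norm_exp (-z))
  rw [(hasSum_cexp (-z)).tsum_eq] at h
  refine h.congr_fun ?_
  intro m
  rw [dcoef, Finset.mul_sum, Finset.sum_mul]
  refine Finset.sum_congr rfl fun k hk => ?_
  have hkm : k ≤ m := Nat.lt_succ_iff.mp (Finset.mem_range.mp hk)
  obtain ⟨l, rfl⟩ := Nat.exists_eq_add_of_le hkm
  rw [Nat.add_sub_cancel_left]
  have e : ((k + l).choose k : ℂ) * k.factorial * l.factorial = (k + l).factorial := by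
    have := Nat.choose_mul_factorial_mul_factorial (Nat.le_add_right k l)
    rw [Nat.add_sub_cancel_left] at this
    exact_mod_cast this
  have f1 : (k.factorial : ℂ) ≠ 0 := by exact_mod_cast k.factorial_ne_zero
  have f2 : (l.factorial : ℂ) ≠ 0 := by exact_mod_cast l.factorial_ne_zero
  have f3 : ((k + l).factorial : ℂ) ≠ 0 := by exact_mod_cast (k + l).factorial_ne_zero
  have e' : ((k + l).choose k : ℂ) / (k + l).factorial = 1 / (k.factorial * l.factorial) := by
    rw [div_eq_div_iff f3 (mul_ne_zero f1 f2), ← e]; ring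
  have e2 : (-1 : ℂ) ^ (k + l) * (-2) ^ k = 2 ^ k * (-1) ^ l := by
    rw [pow_add, show (-2 : ℂ) = (-1) * 2 by norm_num, mul_pow]
    have : (-1 : ℂ) ^ k * (-1) ^ k = 1 := by rw [← mul_pow]; norm_num
    linear_combination (-1 : ℂ) ^ l * 2 ^ k * this
  calc (-1 : ℂ) ^ (k + l) * (((k + l).choose k : ℂ) * (-2) ^ k / k) *
        (z ^ (k + l) / ((k + l).factorial : ℂ))
      = ((-1 : ℂ) ^ (k + l) * (-2) ^ k) * (((k + l).choose k : ℂ) / (k + l).factorial) *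
        z ^ (k + l) / k := by ring
    _ = _ := by
      rw [e2, e', neg_pow z l, mul_pow, pow_add]
      field_simp

lemma hasSum_G (z : ℂ) :
    HasSum (fun k : ℕ => 4 * oddH k * (z ^ (2 * k + 1) / ((2 * k + 1).factorial : ℂ)))
      ((∑' n : ℕ, (2 * z) ^ n / ((n : ℂ) * (n.factorial : ℂ))) * Complex.exp (-z) -
       (∑' n : ℕ, (-(2 * z)) ^ n / ((n : ℂ) * (n.factorial : ℂ))) * Complex.exp z) := by
  have h1 := hasSum_PE z
  have h2 := hasSum_PE (-z)
  rw [neg_neg, mul_neg] at h2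
  have h := h1.sub h2
  have hinj : Function.Injective (fun k : ℕ => 2 * k + 1) := by
    intro a b hab
    simp only at hab
    omega
  rw [← hinj.hasSum_iff] at h
  · refine h.congr_fun ?_
    intro k
    have p : (-1 : ℂ) ^ (2 * k + 1) = -1 := Odd.neg_one_pow ⟨k, rfl⟩
    simp only [Function.comp]
    rw [dcoef_odd, neg_pow z, p]
    ring
  · intro m hm
    have : Even m := by
      rcases Nat.even_or_odd m with h | ⟨k, hk⟩
      · exact h
      · exact absurd ⟨k, hk.symm⟩ hm
    rw [this.neg_pow z]
    ring

lemma hasDerivAt_Gamma_half (k : ℕ) :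
    HasDerivAt Complex.Gamma (Complex.Gamma (1 / 2 + k + 1) *
      (-(Real.eulerMascheroniConstant : ℂ) - 2 * Complex.log 2 + 2 * oddH k)) (1 / 2 + k + 1) := by
  have key : ∀ (s d : ℂ), 0 < s.re → HasDerivAt Complex.Gamma (Complex.Gamma s * d) s →
      HasDerivAt Complex.Gamma (Complex.Gamma (s + 1) * (d + 1 / s)) (s + 1) := by
    intro s d hs h
    have hs0 : s ≠ 0 := by rintro rfl; simp at hs
    have hd : DifferentiableAt ℂ Complex.Gamma (s + 1) := by
      refine Complex.differentiableAt_Gamma _ fun m hm => ?_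
      have := congrArg Complex.re hm
      simp at this
      have hm0 : (0 : ℝ) ≤ m := m.cast_nonneg
      linarith
    have h1 : HasDerivAt (fun t => Complex.Gamma (t + 1)) (deriv Complex.Gamma (s + 1)) s :=
      hd.hasDerivAt.comp_add_const s 1
    have h2 : HasDerivAt (fun t => t * Complex.Gamma t)
        (1 * Complex.Gamma s + s * (Complex.Gamma s * d)) s := (hasDerivAt_id s).mul h
    have h3 : (fun t => Complex.Gamma (t + 1)) =ᶠ[nhds s] fun t => t * Complex.Gamma t := by
      filter_upwards [isOpen_ne.mem_nhds hs0] with t ht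
      exact Complex.Gamma_add_one t ht
    have h4 := h1.unique (h2.congr_of_eventuallyEq h3)
    have h5 := hd.hasDerivAt
    rw [h4] at h5
    refine h5.congr_deriv ?_
    rw [Complex.Gamma_add_one s hs0]
    field_simp
    ring
  induction k with
  | zero =>
    have h := key (1 / 2) (-(Real.eulerMascheroniConstant : ℂ) - 2 * Complex.log 2) (by norm_num)
      (by
        convert! Complex.hasDerivAt_Gamma_one_half using 1
        rw [Complex.Gamma_one_half_eq, Real.sqrt_eq_rpow, Complex.ofReal_cpow Real.pi_pos.le]
        push_cast
        ring)
    convert! h using 1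
    · simp [oddH]
    · simp
  | succ k ih =>
    have h := key _ _ (by
      have : (0 : ℝ) ≤ k := k.cast_nonneg
      simp
      positivity) ih
    have e : oddH (k + 1) = oddH k + 1 / (2 * ((k + 1 : ℕ) : ℂ) + 1) := by
      rw [oddH, Finset.sum_range_succ]; rfl
    have n1 : (2 * ((k + 1 : ℕ) : ℂ) + 1) ≠ 0 := by
      exact_mod_cast Nat.succ_ne_zero (2 * (k + 1))
    have e2 : (1 : ℂ) / (1 / 2 + k + 1) = 2 * (1 / (2 * ((k + 1 : ℕ) : ℂ) + 1)) := by
      rw [show (1 / 2 + k + 1 : ℂ) = (2 * ((k + 1 : ℕ) : ℂ) + 1) / 2 by push_cast; ring]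
      field_simp
    convert! h using 1
    · rw [e, e2]; push_cast; ring_nf
    · push_cast; ring

lemma Gamma_half_fact (k : ℕ) :
    (k.factorial : ℂ) * Complex.Gamma (1 / 2 + k + 1) * 2 ^ (2 * k + 1) =
      (2 * k + 1).factorial * (Real.sqrt Real.pi : ℂ) := by
  have hpi : Complex.Gamma (1 / 2) = (Real.sqrt Real.pi : ℂ) := by
    rw [Complex.Gamma_one_half_eq, Real.sqrt_eq_rpow, Complex.ofReal_cpow Real.pi_pos.le]
    push_cast
    rfl
  induction k with
  | zero =>
    simp only [Nat.cast_zero, add_zero]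
    rw [Complex.Gamma_add_one _ (by norm_num), hpi]
    simp
    ring
  | succ k ih =>
    have n0 : (1 / 2 + k + 1 : ℂ) ≠ 0 := by
      have : (2 * ((k + 1 : ℕ) : ℂ) + 1) ≠ 0 := by
        exact_mod_cast Nat.succ_ne_zero (2 * (k + 1))
      intro h
      apply this
      push_cast
      linear_combination 2 * h
    have e : (1 / 2 + ((k + 1 : ℕ) : ℂ) + 1) = (1 / 2 + k + 1) + 1 := by push_cast; ring
    rw [e, Complex.Gamma_add_one _ n0, show 2 * (k + 1) + 1 = (2 * k + 1 + 1) + 1 by ring,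
      Nat.factorial_succ (2 * k + 1 + 1), Nat.factorial_succ (2 * k + 1), Nat.factorial_succ k,
      pow_succ, pow_succ]
    push_cast
    linear_combination (2 * (k : ℂ) + 3) * (2 * k + 2) * ih

lemma Gamma_inv_bound (s : ℂ) (hs : 0 < s.re) (k : ℕ) :
    ‖(Complex.Gamma (s + k + 1))⁻¹‖ ≤ ‖(Complex.Gamma (s + 1))⁻¹‖ := by
  induction k with
  | zero => simp
  | succ k ih =>
    have hk : (0 : ℝ) ≤ k := k.cast_nonneg
    have hre : 1 ≤ (s + k + 1).re := by simp; linarith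
    have hn : 1 ≤ ‖s + k + 1‖ := hre.trans (Complex.re_le_norm _)
    have n0 : s + k + 1 ≠ 0 := by
      intro h
      rw [h] at hn
      norm_num at hn
    have e : (s + ((k + 1 : ℕ) : ℂ) + 1) = (s + k + 1) + 1 := by push_cast; ring
    rw [e, Complex.Gamma_add_one _ n0, mul_inv, norm_mul, norm_inv (s + k + 1)]
    calc ‖s + k + 1‖⁻¹ * ‖(Complex.Gamma (s + k + 1))⁻¹‖
        ≤ 1 * ‖(Complex.Gamma (s + k + 1))⁻¹‖ := by
          gcongr
          exact inv_le_one_of_one_le₀ hn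
      _ ≤ _ := by rw [one_mul]; exact ih

/-- The terms of the Bessel series. -/
noncomputable def bterm (w : ℂ) (k : ℕ) (ν : ℂ) : ℂ :=
  w ^ k / ((k.factorial : ℂ) * Complex.Gamma (ν + k + 1))

lemma bterm_eq (w : ℂ) (k : ℕ) (ν : ℂ) :
    bterm w k ν = w ^ k / (k.factorial : ℂ) * (Complex.Gamma (ν + k + 1))⁻¹ := by
  rw [bterm, ← div_div, div_eq_mul_inv _ (Complex.Gamma _)]

lemma bterm_diff (w : ℂ) (k : ℕ) : Differentiable ℂ (bterm w k) := by
  have : bterm w k = fun ν => w ^ k / (k.factorial : ℂ) * (Complex.Gamma (ν + k + 1))⁻¹ :=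
    funext fun ν => bterm_eq w k ν
  rw [this]
  refine Differentiable.const_mul ?_ _
  exact Complex.differentiable_one_div_Gamma.comp
    ((differentiable_id.add_const (k : ℂ)).add_const 1)

lemma bterm_bound (w : ℂ) : ∃ u : ℕ → ℝ, Summable u ∧
    ∀ (k : ℕ) (ν : ℂ), ν ∈ Metric.ball (1 / 2 : ℂ) (1 / 2) → ‖bterm w k ν‖ ≤ u k := by
  have hc : Continuous fun ν : ℂ => (Complex.Gamma (ν + 1))⁻¹ :=
    (Complex.differentiable_one_div_Gamma.comp (differentiable_id.add_const 1)).continuous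
  obtain ⟨M, hM⟩ := (isCompact_closedBall (1 / 2 : ℂ) (1 / 2)).exists_bound_of_continuousOn
    hc.continuousOn
  refine ⟨fun k => ‖w ^ k / (k.factorial : ℂ)‖ * M, (summable_norm_exp w).mul_right M, ?_⟩
  intro k ν hν
  have hre : 0 < ν.re := by
    have h1 : ‖ν - 1 / 2‖ < 1 / 2 := by simpa [dist_eq_norm] using hν
    have h2 := (Complex.abs_re_le_norm (ν - 1 / 2)).trans_lt h1
    have h3 := (abs_lt.mp h2).1
    norm_num at h3
    linarith
  rw [bterm_eq, norm_mul]
  exact mul_le_mul_of_nonneg_left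
    ((Gamma_inv_bound ν hre k).trans (hM ν (Metric.ball_subset_closedBall hν))) (norm_nonneg _)

lemma bterm_half (z : ℂ) (hz : z ≠ 0) (k : ℕ) :
    bterm (z ^ 2 / 4) k (1 / 2) =
      2 / ((Real.sqrt Real.pi : ℂ) * z) * (z ^ (2 * k + 1) / ((2 * k + 1).factorial : ℂ)) := by
  have h := Gamma_half_fact k
  have hs : (Real.sqrt Real.pi : ℂ) ≠ 0 := by
    exact_mod_cast (Real.sqrt_pos.mpr Real.pi_pos).ne'
  have f1 : ((2 * k + 1).factorial : ℂ) ≠ 0 := by exact_mod_cast Nat.factorial_ne_zero _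
  have h2 : (2 : ℂ) ^ (2 * k + 1) ≠ 0 := pow_ne_zero _ two_ne_zero
  have n : (k.factorial : ℂ) * Complex.Gamma (1 / 2 + k + 1) =
      (2 * k + 1).factorial * (Real.sqrt Real.pi : ℂ) / 2 ^ (2 * k + 1) := by
    rw [eq_div_iff h2, h]
  rw [bterm, n, div_pow, show (4 : ℂ) ^ k = 2 ^ (2 * k) by rw [pow_mul]; norm_num, ← pow_mul,
    pow_succ, pow_succ]
  field_simp

lemma bterm_deriv (z : ℂ) (hz : z ≠ 0) (k : ℕ) :
    deriv (bterm (z ^ 2 / 4) k) (1 / 2) =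
      -(2 / ((Real.sqrt Real.pi : ℂ) * z) * (z ^ (2 * k + 1) / ((2 * k + 1).factorial : ℂ))) *
      (-(Real.eulerMascheroniConstant : ℂ) - 2 * Complex.log 2 + 2 * oddH k) := by
  have hf : bterm (z ^ 2 / 4) k =
      fun ν => (z ^ 2 / 4) ^ k / (k.factorial : ℂ) * (Complex.Gamma (ν + k + 1))⁻¹ :=
    funext fun ν => bterm_eq _ k ν
  have hG : Complex.Gamma (1 / 2 + k + 1) ≠ 0 := by
    refine Complex.Gamma_ne_zero_of_re_pos ?_
    have : (0 : ℝ) ≤ k := k.cast_nonneg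
    simp
    positivity
  have h1 : HasDerivAt (fun ν : ℂ => Complex.Gamma (ν + k + 1)) (Complex.Gamma (1 / 2 + k + 1) *
      (-(Real.eulerMascheroniConstant : ℂ) - 2 * Complex.log 2 + 2 * oddH k)) (1 / 2) := by
    have h := hasDerivAt_Gamma_half k
    rw [add_assoc] at h
    have := h.comp_add_const (1 / 2) ((k : ℂ) + 1)
    simpa only [add_assoc] using this
  have h2 := (h1.inv hG).const_mul ((z ^ 2 / 4) ^ k / (k.factorial : ℂ))
  rw [← bterm_half z hz k, bterm_eq]
  rw [hf]
  refine h2.deriv.trans ?_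
  field_simp

lemma prefactor (z : ℂ) (hz : z ≠ 0) :
    (z / 2) ^ ((1 : ℂ) / 2) * (2 / ((Real.sqrt Real.pi : ℂ) * z)) =
      2 * (1 / (2 * (Real.pi : ℂ) * z) ^ ((1 : ℂ) / 2)) := by
  have hs : (Real.sqrt Real.pi : ℂ) ≠ 0 := by
    exact_mod_cast (Real.sqrt_pos.mpr Real.pi_pos).ne'
  have hp : (2 * Real.sqrt Real.pi : ℂ) = (2 * (Real.pi : ℂ) * 2) ^ ((1 : ℂ) / 2) := by
    have : Real.sqrt (2 * Real.pi * 2) = 2 * Real.sqrt Real.pi := by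
      rw [show 2 * Real.pi * 2 = 2 ^ 2 * Real.pi by ring, Real.sqrt_mul (by positivity),
        Real.sqrt_sq (by norm_num)]
    have h2 : ((Real.sqrt (2 * Real.pi * 2) : ℝ) : ℂ) =
        (2 * (Real.pi : ℂ) * 2) ^ ((1 : ℂ) / 2) := by
      rw [Real.sqrt_eq_rpow, Complex.ofReal_cpow (by positivity)]
      push_cast
      rfl
    rw [← h2, this]
    push_cast
    rfl
  have e : (2 * (Real.pi : ℂ) * z) ^ ((1 : ℂ) / 2) =
      (2 * Real.sqrt Real.pi : ℂ) * (z / 2) ^ ((1 : ℂ) / 2) := by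
    rw [hp, show 2 * (Real.pi : ℂ) * z = ((2 * Real.pi * 2 : ℝ) : ℂ) * (z / 2) by push_cast; ring]
    have hz2 : z / 2 ≠ 0 := div_ne_zero hz two_ne_zero
    have hr : (0 : ℝ) < 2 * Real.pi * 2 := by positivity
    have hr0 : ((2 * Real.pi * 2 : ℝ) : ℂ) ≠ 0 := by exact_mod_cast hr.ne'
    rw [show 2 * (Real.pi : ℂ) * 2 = ((2 * Real.pi * 2 : ℝ) : ℂ) by push_cast; ring]
    rw [Complex.cpow_def_of_ne_zero (mul_ne_zero hr0 hz2), Complex.cpow_def_of_ne_zero hr0,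
      Complex.cpow_def_of_ne_zero hz2, ← Complex.exp_add, Complex.log_ofReal_mul hr hz2,
      Complex.ofReal_log hr.le]
    ring_nf
  have hq : (z / 2) ^ ((1 : ℂ) / 2) * (z / 2) ^ ((1 : ℂ) / 2) = z / 2 := by
    have hz2 : z / 2 ≠ 0 := div_ne_zero hz two_ne_zero
    rw [← Complex.cpow_add _ _ hz2]
    norm_num
  have hq0 : (z / 2) ^ ((1 : ℂ) / 2) ≠ 0 := by
    intro h
    rw [h] at hq
    exact (div_ne_zero hz two_ne_zero) (by rw [← hq]; ring)
  rw [e]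
  generalize (z / 2) ^ ((1 : ℂ) / 2) = q at *
  have : z = 2 * (q * q) := by rw [hq]; ring
  rw [this]
  field_simp

theorem stmt3 (z : ℂ) (hz : z ∉ Complex.ofReal '' Set.Iic (0 : ℝ)) :
    deriv (fun ν : ℂ => besselI ν z) (1 / 2) =
      -(1 / (2 * (Real.pi : ℂ) * z) ^ ((1 : ℂ) / 2)) *
        (expIntEi (2 * z) * Complex.exp (-z) + expIntE1 (2 * z) * Complex.exp z) := by
  have hz0 : z ≠ 0 := by
    rintro rfl
    exact hz ⟨0, by simp, by simp⟩
  have hz2 : z / 2 ≠ 0 := div_ne_zero hz0 two_ne_zero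
  obtain ⟨u, hu, hb⟩ := bterm_bound (z ^ 2 / 4)
  have hmem : (1 / 2 : ℂ) ∈ Metric.ball (1 / 2 : ℂ) (1 / 2) := Metric.mem_ball_self (by norm_num)
  have hdiff := (differentiableOn_tsum_of_summable_norm hu
    (fun k => (bterm_diff (z ^ 2 / 4) k).differentiableOn) Metric.isOpen_ball hb).differentiableAt
    (Metric.isOpen_ball.mem_nhds hmem)
  have hsum := hasSum_deriv_of_summable_norm hu
    (fun k => (bterm_diff (z ^ 2 / 4) k).differentiableOn) Metric.isOpen_ball hb hmem
  have hval : ∑' k : ℕ, bterm (z ^ 2 / 4) k (1 / 2) =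
      2 / ((Real.sqrt Real.pi : ℂ) * z) * Complex.sinh z := by
    simp only [bterm_half z hz0]
    exact ((Complex.hasSum_sinh z).mul_left _).tsum_eq
  set G := (∑' n : ℕ, (2 * z) ^ n / ((n : ℂ) * (n.factorial : ℂ))) * Complex.exp (-z) -
       (∑' n : ℕ, (-(2 * z)) ^ n / ((n : ℂ) * (n.factorial : ℂ))) * Complex.exp z with hG
  have hder : deriv (fun ν : ℂ => ∑' k : ℕ, bterm (z ^ 2 / 4) k ν) (1 / 2) =
      -(2 / ((Real.sqrt Real.pi : ℂ) * z)) *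
        ((-(Real.eulerMascheroniConstant : ℂ) - 2 * Complex.log 2) * Complex.sinh z + G / 2) := by
    refine hsum.unique ?_
    have h := ((((Complex.hasSum_sinh z).mul_left
      (-(Real.eulerMascheroniConstant : ℂ) - 2 * Complex.log 2)).add
      ((hasSum_G z).mul_left (1 / 2))).mul_left (-(2 / ((Real.sqrt Real.pi : ℂ) * z))))
    rw [← hG, show (1 / 2 : ℂ) * G = G / 2 by ring] at h
    refine h.congr_fun ?_
    intro k
    rw [bterm_deriv z hz0 k]
    ring
  have hpow : HasDerivAt (fun ν : ℂ => (z / 2) ^ ν)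
      ((z / 2) ^ ((1 : ℂ) / 2) * Complex.log (z / 2)) (1 / 2) := by
    simpa using (hasDerivAt_id ((1 : ℂ) / 2)).const_cpow (c := z / 2) (Or.inl hz2)
  have hmain := (hpow.mul hdiff.hasDerivAt).deriv
  have hfun : (fun ν : ℂ => besselI ν z) =
      (fun ν : ℂ => (z / 2) ^ ν) * (fun ν : ℂ => ∑' k : ℕ, bterm (z ^ 2 / 4) k ν) := rfl
  have hE : ∑' n : ℕ, (-1 : ℂ) ^ (n + 1) * (2 * z) ^ (n + 1) /
      (((n : ℂ) + 1) * ((n + 1).factorial : ℂ)) =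
      ∑' n : ℕ, (-(2 * z)) ^ n / ((n : ℂ) * (n.factorial : ℂ)) := by
    rw [← tsum_P_shift]
    refine tsum_congr fun n => ?_
    rw [← mul_pow, neg_one_mul]
  have hl1 : Complex.log (2 * z) = Complex.log 2 + Complex.log z := by
    have := Complex.log_ofReal_mul (r := 2) two_pos hz0
    rw [Complex.ofReal_log zero_le_two] at this
    simpa using this
  have hl2 : Complex.log (z / 2) = Complex.log z - Complex.log 2 := by
    have := Complex.log_ofReal_mul (r := 2) two_pos hz2
    rw [Complex.ofReal_log zero_le_two] at this
    have h2 : ((2 : ℝ) : ℂ) * (z / 2) = z := by push_cast; field_simp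
    rw [h2] at this
    rw [this]
    simp
  rw [hfun, hmain, hder, hval, expIntEi, expIntE1, tsum_P_shift, hE, hl1, hl2]
  have hp := prefactor z hz0
  rw [Complex.sinh, hG]
  generalize ∑' n : ℕ, (2 * z) ^ n / ((n : ℂ) * (n.factorial : ℂ)) = A
  generalize ∑' n : ℕ, (-(2 * z)) ^ n / ((n : ℂ) * (n.factorial : ℂ)) = B
  linear_combination (((Complex.log z - Complex.log 2) +
    (Real.eulerMascheroniConstant : ℂ) + 2 * Complex.log 2) *
    ((Complex.exp z - Complex.exp (-z)) / 2) - (A * Complex.exp (-z) - B * Complex.exp z) / 2) * hp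
end

section
/- For every z ∈ ℂ with z ∉ (-∞,0], the derivative at ν = −1/2 of the map ν ↦ I_ν(z) equals (1/√(2πz)) · (Ei(2z)·e^{−z} − E₁(2z)·e^{z}), where the square root is the principal branch. -/
open Complex

/-- binomial coefficients sums -/
noncomputable def cA (m : ℕ) : ℂ :=
  ∑ n ∈ Finset.range (m + 1), (m.choose n : ℂ) * 2 ^ n * (-1) ^ (m - n) / n

lemma cA_succ (m : ℕ) : cA (m + 1) = -cA m + (1 + (-1) ^ m) / (m + 1) := by
  have h0 : ((m : ℂ) + 1) ≠ 0 := by exact_mod_cast Nat.succ_ne_zero m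
  have e1 : cA (m + 1) = ∑ n ∈ Finset.range (m + 1),
      ((m + 1).choose (n + 1) : ℂ) * 2 ^ (n + 1) * (-1) ^ (m - n) / ((n : ℂ) + 1) := by
    rw [cA, Finset.sum_range_succ']
    simp
  have e2 : cA m = ∑ n ∈ Finset.range (m + 1),
      (m.choose (n + 1) : ℂ) * 2 ^ (n + 1) * (-(-1) ^ (m - n)) / ((n : ℂ) + 1) := by
    rw [cA, Finset.sum_range_succ', Finset.sum_range_succ]
    simp only [Nat.choose_succ_self, Nat.cast_zero, div_zero, zero_mul, zero_div]
    congr 1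
    refine Finset.sum_congr rfl fun n hn => ?_
    have : m - n = (m - (n + 1)) + 1 := by have := Finset.mem_range.1 hn; omega
    rw [this, pow_succ]
    push_cast
    ring
  have e3 : cA (m + 1) + cA m = (1 + (-1) ^ m) / (m + 1) := by
    have hb := add_pow (2 : ℂ) (-1) (m + 1)
    rw [Finset.sum_range_succ'] at hb
    have hb' : (∑ n ∈ Finset.range (m + 1),
      ((m + 1).choose (n + 1) : ℂ) * 2 ^ (n + 1) * (-1) ^ (m - n)) = 1 + (-1) ^ m := by
      have : ((2 : ℂ) + -1) ^ (m + 1) = 1 := by norm_num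
      rw [this] at hb
      simp only [pow_zero, Nat.choose_zero_right, Nat.cast_one, mul_one, one_mul, Nat.sub_zero,
        Nat.add_sub_add_right] at hb
      rw [pow_succ (-1 : ℂ) m] at hb
      have h2 : (∑ n ∈ Finset.range (m + 1),
        ((m + 1).choose (n + 1) : ℂ) * 2 ^ (n + 1) * (-1) ^ (m - n)) =
        ∑ n ∈ Finset.range (m + 1),
        2 ^ (n + 1) * (-1) ^ (m - n) * ((m + 1).choose (n + 1) : ℂ) :=
        Finset.sum_congr rfl fun n _ => by ring
      rw [h2]
      linear_combination -hb
    rw [e1, e2, ← Finset.sum_add_distrib, ← hb', Finset.sum_div]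
    refine Finset.sum_congr rfl fun n _ => ?_
    have hn : ((n : ℂ) + 1) ≠ 0 := by exact_mod_cast Nat.succ_ne_zero n
    have hc : ((m : ℂ) + 1) * m.choose n = (m + 1).choose (n + 1) * ((n : ℂ) + 1) := by
      exact_mod_cast Nat.add_one_mul_choose_eq m n
    have hp : ((m + 1).choose (n + 1) : ℂ) = m.choose n + m.choose (n + 1) := by
      exact_mod_cast Nat.choose_succ_succ m n
    field_simp
    linear_combination ((m : ℂ) + 1) * hp + hc
  linear_combination e3

/-- odd harmonic sums -/
noncomputable def cO (k : ℕ) : ℂ := ∑ j ∈ Finset.range k, 1 / (2 * (j : ℂ) + 1)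

lemma cA_even (k : ℕ) : cA (2 * k) = -2 * cO k := by
  induction k with
  | zero => simp [cA, cO]
  | succ k ih =>
    rw [show 2 * (k + 1) = 2 * k + 1 + 1 by ring, cA_succ, cA_succ, ih, cO, cO,
      Finset.sum_range_succ, pow_succ, pow_mul]
    push_cast
    norm_num
    ring

/-- the entire part of the exponential integral -/
noncomputable def cS (w : ℂ) : ℂ :=
  ∑' n : ℕ, w ^ (n + 1) / (((n : ℂ) + 1) * ((n + 1).factorial : ℂ))

lemma cS_summable (w : ℂ) : Summable fun n : ℕ => ‖w ^ n / ((n : ℂ) * (n.factorial : ℂ))‖ := by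
  refine Summable.of_nonneg_of_le (fun _ => norm_nonneg _) (fun n => ?_)
    (Real.summable_pow_div_factorial ‖w‖)
  rw [norm_div, norm_mul, norm_pow, Complex.norm_natCast, Complex.norm_natCast]
  rcases Nat.eq_zero_or_pos n with rfl | hn
  · simp
  · have h1 : (1 : ℝ) ≤ n := by exact_mod_cast hn
    have h2 : (0 : ℝ) < n.factorial := by exact_mod_cast n.factorial_pos
    gcongr
    nlinarith

lemma cS_eq (w : ℂ) : cS w = ∑' n : ℕ, w ^ n / ((n : ℂ) * (n.factorial : ℂ)) := by
  rw [(cS_summable w).of_norm.tsum_eq_zero_add, cS]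
  simp

lemma cS_hasSum (z : ℂ) :
    HasSum (fun m : ℕ => cA m * z ^ m / (m.factorial : ℂ)) (cS (2 * z) * exp (-z)) := by
  have hf := cS_summable (2 * z)
  have hg : Summable fun n : ℕ => ‖(-z) ^ n / (n.factorial : ℂ)‖ :=
    NormedSpace.norm_expSeries_div_summable (-z)
  have he : exp (-z) = ∑' n : ℕ, (-z) ^ n / (n.factorial : ℂ) := by
    rw [Complex.exp_eq_exp_ℂ, NormedSpace.exp_eq_tsum_div]
  have hs := (summable_norm_sum_mul_range_of_summable_norm hf hg).of_norm.hasSum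
  rw [← tsum_mul_tsum_eq_tsum_sum_range_of_summable_norm hf hg, ← cS_eq, ← he] at hs
  convert! hs using 2 with m
  rw [cA, Finset.sum_mul, Finset.sum_div]
  refine Finset.sum_congr rfl fun n hn => ?_
  have hnm : n ≤ m := by have := Finset.mem_range.1 hn; omega
  have hc : (m.choose n : ℂ) * n.factorial * (m - n).factorial = m.factorial := by
    exact_mod_cast Nat.choose_mul_factorial_mul_factorial hnm
  have h1 : (n.factorial : ℂ) ≠ 0 := by exact_mod_cast n.factorial_ne_zero
  have h2 : ((m - n).factorial : ℂ) ≠ 0 := by exact_mod_cast (m - n).factorial_ne_zero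
  have h3 : (m.factorial : ℂ) ≠ 0 := by exact_mod_cast m.factorial_ne_zero
  have hz : z ^ m = z ^ n * z ^ (m - n) := by rw [← pow_add]; congr 1; omega
  rcases Nat.eq_zero_or_pos n with rfl | hn
  · simp
  · have h4 : (n : ℂ) ≠ 0 := by exact_mod_cast hn.ne'
    rw [neg_pow z, mul_pow, hz, ← hc]
    have h5 : (m.choose n : ℂ) ≠ 0 := by
      exact_mod_cast (Nat.choose_pos hnm).ne'
    field_simp

lemma key_sum (z : ℂ) :
    HasSum (fun k : ℕ => -4 * cO k * z ^ (2 * k) / ((2 * k).factorial : ℂ))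
      (cS (2 * z) * exp (-z) + cS (-(2 * z)) * exp z) := by
  have h := (cS_hasSum z).add (cS_hasSum (-z))
  rw [neg_neg, mul_neg] at h
  have hi : Function.Injective fun k : ℕ => 2 * k := fun a b h => by simpa using h
  rw [← hi.hasSum_iff] at h
  · convert! h using 2 with k
    simp only [Function.comp, cA_even]
    rw [(even_two_mul k).neg_pow]
    ring
  · intro m hm
    have : Odd m := by
      rw [← Nat.not_even_iff_odd]
      rintro ⟨r, hr⟩
      exact hm ⟨r, by simp; omega⟩
    rw [this.neg_pow]
    ring

lemma Gamma_step (k : ℕ) (ν : ℂ) (h : ν + k + 1 ≠ 0) :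
    (Gamma (ν + (k + 1 : ℕ) + 1))⁻¹ = (Gamma (ν + k + 1))⁻¹ / (ν + k + 1) := by
  have := Complex.Gamma_add_one (ν + k + 1) h
  rw [show ν + (k + 1 : ℕ) + 1 = ν + k + 1 + 1 by push_cast; ring, this, mul_inv]
  field_simp

lemma Gamma_bound : ∃ C : ℝ, ∀ (k : ℕ) (ν : ℂ), ν ∈ Metric.ball (-(1 / 2) : ℂ) (1 / 4) →
    ‖(Gamma (ν + k + 1))⁻¹‖ ≤ C * 4 ^ k := by
  have hc : Continuous fun ν : ℂ => (Gamma (ν + 1))⁻¹ :=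
    (Complex.differentiable_one_div_Gamma.comp (differentiable_id.add_const 1)).continuous
  obtain ⟨C, hC⟩ := (isCompact_closedBall (-(1 / 2) : ℂ) (1 / 4)).exists_bound_of_continuousOn
    hc.continuousOn
  refine ⟨C, fun k ν hν => ?_⟩
  induction k with
  | zero => simpa using hC ν (Metric.ball_subset_closedBall hν)
  | succ k ih =>
    have hre : 1 / 4 ≤ (ν + k + 1).re := by
      rw [Metric.mem_ball, Complex.dist_eq] at hν
      have h1 := (abs_le.1 (Complex.abs_re_le_norm (ν - -(1 / 2)))).1
      have h2 : (0 : ℝ) ≤ k := k.cast_nonneg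
      simp at h1 ⊢
      norm_num at h1 hν ⊢
      linarith
    have hn : 1 / 4 ≤ ‖ν + k + 1‖ := hre.trans (Complex.re_le_norm _)
    have h0 : ν + k + 1 ≠ 0 := by
      rw [← norm_pos_iff]; linarith
    rw [Gamma_step k ν h0, norm_div, div_le_iff₀ (by linarith), pow_succ]
    have := (norm_nonneg _).trans ih
    nlinarith

lemma term_deriv (k : ℕ) :
    ((k.factorial : ℂ) * Gamma (-(1 / 2) + k + 1))⁻¹
        = 4 ^ k / ((2 * k).factorial : ℂ) / (Real.pi : ℂ) ^ (1 / 2 : ℂ) ∧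
    HasDerivAt (fun ν : ℂ => ((k.factorial : ℂ) * Gamma (ν + k + 1))⁻¹)
      (4 ^ k / ((2 * k).factorial : ℂ) / (Real.pi : ℂ) ^ (1 / 2 : ℂ) *
        (Real.eulerMascheroniConstant + 2 * Complex.log 2 - 2 * cO k)) (-(1 / 2)) := by
  induction k with
  | zero =>
    have hpi : (Real.pi : ℂ) ^ (1 / 2 : ℂ) ≠ 0 := by
      rw [Ne, Complex.cpow_eq_zero_iff]; simp [Real.pi_ne_zero]
    have hg : Gamma (-(1 / 2) + (0 : ℕ) + 1) = (Real.pi : ℂ) ^ (1 / 2 : ℂ) := by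
      rw [← Complex.Gamma_one_half_eq]; norm_num
    refine ⟨by rw [hg]; simp, ?_⟩
    have h := Complex.hasDerivAt_Gamma_one_half
    have hsq : ((Real.sqrt Real.pi : ℝ) : ℂ) = (Real.pi : ℂ) ^ (1 / 2 : ℂ) := by
      rw [Real.sqrt_eq_rpow, Complex.ofReal_cpow Real.pi_pos.le]; simp
    rw [show (1 / 2 : ℂ) = -(1 / 2) + 1 by norm_num] at h
    have h1 := h.comp_add_const (-(1 / 2)) 1
    have hg' : Gamma (-(1 / 2) + 1) = (Real.pi : ℂ) ^ (1 / 2 : ℂ) := by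
      rw [← Complex.Gamma_one_half_eq]; norm_num
    have h2 := h1.inv (by rw [hg']; exact hpi)
    have h3 : (fun ν : ℂ => (((0 : ℕ).factorial : ℂ) * Gamma (ν + (0 : ℕ) + 1))⁻¹) =
        (fun ν : ℂ => Gamma (ν + 1))⁻¹ := by
      funext ν
      simp
    rw [h3]
    refine h2.congr_deriv ?_
    rw [hg', hsq]
    simp only [cO, Finset.range_zero, Finset.sum_empty]
    field_simp
    simp
  | succ k ih =>
    obtain ⟨ih1, ih2⟩ := ih
    have hk : (2 * (k : ℂ) + 1) ≠ 0 := by exact_mod_cast Nat.succ_ne_zero (2 * k)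
    have hk1 : ((k : ℂ) + 1) ≠ 0 := by exact_mod_cast Nat.succ_ne_zero k
    have hv : (-(1 / 2) + (k : ℂ) + 1) = (2 * k + 1) / 2 := by ring
    have h0 : (-(1 / 2) + (k : ℂ) + 1) ≠ 0 := by
      rw [hv]; exact div_ne_zero hk two_ne_zero
    have hs : ∀ ν : ℂ, ν + k + 1 ≠ 0 → (((k + 1).factorial : ℂ) * Gamma (ν + (k + 1 : ℕ) + 1))⁻¹
        = ((k.factorial : ℂ) * Gamma (ν + k + 1))⁻¹ * ((k + 1) * (ν + k + 1))⁻¹ := by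
      intro ν hν
      rw [mul_inv, Gamma_step k ν hν, Nat.factorial_succ]
      push_cast
      simp only [mul_inv]
      ring
    have hf : ((2 * (k + 1)).factorial : ℂ) = (2 * k + 2) * (2 * k + 1) * (2 * k).factorial := by
      rw [show 2 * (k + 1) = 2 * k + 1 + 1 by ring, Nat.factorial_succ, Nat.factorial_succ]
      push_cast; ring
    have hF : ((2 * k).factorial : ℂ) ≠ 0 := by exact_mod_cast Nat.factorial_ne_zero _
    have hpi : (Real.pi : ℂ) ^ (1 / 2 : ℂ) ≠ 0 := by
      rw [Ne, Complex.cpow_eq_zero_iff]; simp [Real.pi_ne_zero]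
    have h22 : (2 * (k : ℂ) + 2) = 2 * (k + 1) := by ring
    constructor
    · rw [hs _ h0, ih1, hf, hv, h22, pow_succ]
      field_simp
      norm_num
    · have hd : HasDerivAt (fun ν : ℂ => ((k + 1) * (ν + k + 1))) ((k : ℂ) + 1) (-(1 / 2)) := by
        simpa using (((hasDerivAt_id (-(1 / 2) : ℂ)).add_const (k : ℂ)).add_const 1).const_mul
          ((k : ℂ) + 1)
      have hd2 := ih2.mul (hd.inv (mul_ne_zero hk1 h0))
      have hev : (fun ν : ℂ => (((k + 1).factorial : ℂ) * Gamma (ν + (k + 1 : ℕ) + 1))⁻¹)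
          =ᶠ[nhds (-(1 / 2))] fun ν => ((k.factorial : ℂ) * Gamma (ν + k + 1))⁻¹ *
            ((k + 1) * (ν + k + 1))⁻¹ := by
        have hcont : ContinuousAt (fun ν : ℂ => ν + k + 1) (-(1 / 2)) := by fun_prop
        filter_upwards [hcont.eventually_ne h0] with ν hν using hs ν hν
      refine (HasDerivAt.congr_of_eventuallyEq hd2 hev).congr_deriv ?_
      simp only [Pi.inv_apply]
      rw [ih1, hf, hv, h22, pow_succ (4 : ℂ), show cO (k + 1) = cO k + 1 / (2 * (k : ℂ) + 1) from Finset.sum_range_succ _ _]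
      field_simp
      ring

lemma sum_deriv (z : ℂ) :
    HasDerivAt (fun ν : ℂ =>
      ∑' k : ℕ, (z ^ 2 / 4) ^ k / ((k.factorial : ℂ) * Complex.Gamma (ν + k + 1)))
      (1 / (Real.pi : ℂ) ^ (1 / 2 : ℂ) *
        ((Real.eulerMascheroniConstant + 2 * Complex.log 2) * Complex.cosh z +
          (cS (2 * z) * exp (-z) + cS (-(2 * z)) * exp z) / 2)) (-(1 / 2)) := by
  obtain ⟨C, hC⟩ := Gamma_bound
  set F : ℕ → ℂ → ℂ := fun k ν =>
    (z ^ 2 / 4) ^ k / ((k.factorial : ℂ) * Complex.Gamma (ν + k + 1)) with hF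
  have hu : Summable fun k : ℕ => C * (‖z ^ 2‖ ^ k / (k.factorial : ℝ)) :=
    (Real.summable_pow_div_factorial ‖z ^ 2‖).mul_left C
  have hmem : (-(1 / 2) : ℂ) ∈ Metric.ball (-(1 / 2) : ℂ) (1 / 4) := by simp
  have hd : ∀ k, DifferentiableOn ℂ (F k) (Metric.ball (-(1 / 2) : ℂ) (1 / 4)) := by
    intro k
    have h1 : Differentiable ℂ fun ν : ℂ => (Gamma (ν + k + 1))⁻¹ :=
      Complex.differentiable_one_div_Gamma.comp
        ((differentiable_id.add_const (k : ℂ)).add_const 1)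
    have h2 := (h1.const_mul ((z ^ 2 / 4) ^ k / (k.factorial : ℂ))).differentiableOn
      (s := Metric.ball (-(1 / 2) : ℂ) (1 / 4))
    refine h2.congr fun ν _ => ?_
    simp only [hF]
    rw [← div_div, div_eq_mul_inv]
  have hb : ∀ k ν, ν ∈ Metric.ball (-(1 / 2) : ℂ) (1 / 4) →
      ‖F k ν‖ ≤ C * (‖z ^ 2‖ ^ k / (k.factorial : ℝ)) := by
    intro k ν hν
    have h := hC k ν hν
    have hk : (0 : ℝ) < k.factorial := by exact_mod_cast k.factorial_pos
    simp only [hF]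
    rw [← div_div, div_eq_mul_inv, norm_mul, norm_div, norm_pow, norm_div, Complex.norm_natCast]
    calc _ ≤ (‖z ^ 2‖ / ‖(4 : ℂ)‖) ^ k / (k.factorial : ℝ) * (C * 4 ^ k) := by gcongr
      _ = _ := by
        rw [div_pow]
        norm_num
        field_simp
  have hdiff := (differentiableOn_tsum_of_summable_norm hu hd Metric.isOpen_ball hb).differentiableAt
    (Metric.isOpen_ball.mem_nhds hmem)
  have hsum := hasSum_deriv_of_summable_norm hu hd Metric.isOpen_ball hb hmem
  refine hdiff.hasDerivAt.congr_deriv (hsum.unique ?_)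
  have h3 := ((Complex.hasSum_cosh z).mul_left
    (Real.eulerMascheroniConstant + 2 * Complex.log 2)).add ((key_sum z).div_const 2)
  have h4 := h3.mul_left (1 / (Real.pi : ℂ) ^ (1 / 2 : ℂ))
  convert! h4 using 2 with k
  have h5 := ((term_deriv k).2.const_mul ((z ^ 2 / 4) ^ k)).deriv
  have h6 : F k = fun ν => (z ^ 2 / 4) ^ k * ((k.factorial : ℂ) * Gamma (ν + k + 1))⁻¹ := by
    funext ν
    simp only [hF, div_eq_mul_inv]
  rw [h6, h5, div_pow, pow_mul]
  field_simp
  ring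

theorem stmt4 (z : ℂ) (hz : z ∉ Complex.ofReal '' Set.Iic (0 : ℝ)) :
    deriv (fun ν : ℂ => besselI ν z) (-(1 / 2)) =
      (1 / (2 * (Real.pi : ℂ) * z) ^ ((1 : ℂ) / 2)) *
        (expIntEi (2 * z) * Complex.exp (-z) - expIntE1 (2 * z) * Complex.exp z) := by
  have hz0 : z ≠ 0 := by
    rintro rfl
    exact hz ⟨0, by simp, by simp⟩
  have hpi := Real.pi_pos
  have hpi0 : (Real.pi : ℂ) ≠ 0 := by exact_mod_cast hpi.ne'
  have l1 : log (2 * z) = log 2 + log z := by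
    have := Complex.log_ofReal_mul (r := 2) (by norm_num) hz0
    rw [Complex.ofReal_log (by norm_num)] at this
    simpa using this
  have l2 : log (z / 2) = log z - log 2 := by
    have := Complex.log_ofReal_mul (r := 1 / 2) (by norm_num) hz0
    rw [one_div, Real.log_inv, Complex.ofReal_neg, Complex.ofReal_log (by norm_num)] at this
    rw [show z / 2 = ((2⁻¹ : ℝ) : ℂ) * z by push_cast; ring, this]
    push_cast
    ring
  have l3 : log (2 * (Real.pi : ℂ) * z) = log 2 + log Real.pi + log z := by
    have := Complex.log_ofReal_mul (r := 2 * Real.pi) (by positivity) hz0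
    rw [Real.log_mul (by norm_num) hpi.ne', Complex.ofReal_add, Complex.ofReal_log (by norm_num),
      Complex.ofReal_log hpi.le] at this
    simpa using this
  have hzz : z / 2 ≠ 0 := div_ne_zero hz0 two_ne_zero
  have hpow : (z / 2) ^ (-(1 / 2) : ℂ) * (1 / (Real.pi : ℂ) ^ (1 / 2 : ℂ)) =
      2 * (1 / (2 * (Real.pi : ℂ) * z) ^ ((1 : ℂ) / 2)) := by
    rw [Complex.cpow_def_of_ne_zero hzz, Complex.cpow_def_of_ne_zero hpi0,
      Complex.cpow_def_of_ne_zero (by simp [hz0, hpi0]), l2, l3, one_div, one_div, one_div,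
      ← Complex.exp_neg, ← Complex.exp_neg, ← Complex.exp_add]
    conv_rhs => rw [← Complex.exp_log (two_ne_zero (α := ℂ))]
    rw [← Complex.exp_add, Complex.exp_log two_ne_zero]
    congr 1
    ring
  have hp : HasDerivAt (fun ν : ℂ => (z / 2) ^ ν) ((z / 2) ^ (-(1 / 2) : ℂ) * log (z / 2))
      (-(1 / 2)) := by
    simpa using (hasDerivAt_id (-(1 / 2) : ℂ)).const_cpow (Or.inl hzz)
  have hval : (∑' k : ℕ, (z ^ 2 / 4) ^ k / ((k.factorial : ℂ) * Complex.Gamma (-(1 / 2) + k + 1)))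
      = 1 / (Real.pi : ℂ) ^ (1 / 2 : ℂ) * cosh z := by
    refine HasSum.tsum_eq ?_
    convert! (Complex.hasSum_cosh z).mul_left (1 / (Real.pi : ℂ) ^ (1 / 2 : ℂ)) using 2 with k
    rw [div_eq_mul_inv, (term_deriv k).1, div_pow, pow_mul]
    field_simp
  have hEi : expIntEi (2 * z) = Real.eulerMascheroniConstant + log (2 * z) + cS (2 * z) := rfl
  have hE1 : expIntE1 (2 * z) =
      -Real.eulerMascheroniConstant - log (2 * z) - cS (-(2 * z)) := by
    rw [expIntE1, cS]
    congr 2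
    funext n
    rw [neg_pow (2 * z)]
  have hmain := (hp.mul (sum_deriv z)).deriv
  have hfun : (fun ν : ℂ => besselI ν z) = (fun ν : ℂ => (z / 2) ^ ν) * fun ν : ℂ =>
      ∑' k : ℕ, (z ^ 2 / 4) ^ k / ((k.factorial : ℂ) * Complex.Gamma (ν + k + 1)) := rfl
  rw [hfun, hmain, hval, hEi, hE1, l1, l2]
  rw [Complex.cosh]
  linear_combination ((log z + log 2 + Real.eulerMascheroniConstant) * ((exp z + exp (-z)) / 2) +
    (cS (2 * z) * exp (-z) + cS (-(2 * z)) * exp z) / 2) * hpow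
end

section
/- For every z ∈ ℂ with z ∉ (-∞,0], the derivative at ν = −1 of the map ν ↦ j_ν(z) equals (Ci(2z)·cos z + Si(2z)·sin z)/z. -/
open Complex

/-- The Bessel function of the first kind
`J_ν(z) = (z/2)^ν ∑_{k≥0} (−1)^k (z²/4)^k / (k! Γ(ν+k+1))`, with the principal power. -/
noncomputable def besselJ (ν z : ℂ) : ℂ :=
  (z / 2) ^ ν *
    ∑' k : ℕ, (-1) ^ k * (z ^ 2 / 4) ^ k / ((k.factorial : ℂ) * Complex.Gamma (ν + k + 1))

/-- The spherical Bessel function of the first kind `j_ν(z) = √(π/(2z)) J_{ν+1/2}(z)`. -/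
noncomputable def sphBesselJ (ν z : ℂ) : ℂ :=
  ((Real.pi : ℂ) / (2 * z)) ^ ((1 : ℂ) / 2) * besselJ (ν + 1 / 2) z

/-- The sine integral `Si(z) = ∑_{n≥0} (−1)ⁿ z^{2n+1}/((2n+1)(2n+1)!)`. -/
noncomputable def sinIntegral (z : ℂ) : ℂ :=
  ∑' n : ℕ, (-1) ^ n * z ^ (2 * n + 1) / ((2 * (n : ℂ) + 1) * ((2 * n + 1).factorial : ℂ))

/-- The cosine integral `Ci(z) = γ + Log z + ∑_{n≥1} (−1)ⁿ z^{2n}/(2n·(2n)!)`. -/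
noncomputable def cosIntegral (z : ℂ) : ℂ :=
  (Real.eulerMascheroniConstant : ℂ) + Complex.log z +
    ∑' n : ℕ, (-1) ^ (n + 1) * z ^ (2 * (n + 1)) /
      ((2 * ((n : ℂ) + 1)) * ((2 * (n + 1)).factorial : ℂ))


lemma hasSum_congr_aux {f g : ℕ → ℂ} {a : ℂ} (h : ∀ n, f n = g n) : HasSum f a ↔ HasSum g a := by
  rw [funext h]

lemma two_k_ne (k : ℕ) : (2 * k + 1 : ℂ) ≠ 0 := by exact_mod_cast Nat.succ_ne_zero (2*k)
lemma sqrtpi_ne : (Real.sqrt Real.pi : ℂ) ≠ 0 := by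
    simp [Real.sqrt_ne_zero', Real.pi_pos]

lemma k_half_ne (k : ℕ) : (k:ℂ) + 1/2 ≠ 0 := by
  have := two_k_ne k
  intro h; apply this; linear_combination 2 * h

lemma rgamma_step (k : ℕ) : ((k:ℂ) + 1/2) * (4 ^ (k+1) * ((k+1).factorial : ℂ) / ((Real.sqrt Real.pi : ℂ) * ((2*(k+1)).factorial : ℂ))) = 4 ^ k * (k.factorial : ℂ) / ((Real.sqrt Real.pi : ℂ) * ((2*k).factorial : ℂ)) := by
  have h1 : (2*(k+1)).factorial = (2*k+2)*((2*k+1)*(2*k).factorial) := by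
    rw [show 2*(k+1) = (2*k+1)+1 by ring, Nat.factorial_succ, Nat.factorial_succ]
  rw [h1, Nat.factorial_succ]
  have := two_k_ne k
  have := sqrtpi_ne
  have : ((2*k).factorial : ℂ) ≠ 0 := by exact_mod_cast Nat.factorial_ne_zero _
  have : (k + 1 : ℂ) ≠ 0 := by exact_mod_cast Nat.succ_ne_zero k
  have : (2 * k + 2 : ℂ) ≠ 0 := by exact_mod_cast Nat.succ_ne_zero (2*k+1)
  rw [show (k:ℂ) + 1/2 = (2*k+1)/2 by ring]
  push_cast
  field_simp
  ring

lemma rgamma_val (k : ℕ) : (Complex.Gamma ((k:ℂ) + 1/2))⁻¹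
    = 4 ^ k * (k.factorial : ℂ) / ((Real.sqrt Real.pi : ℂ) * ((2*k).factorial : ℂ)) := by
  induction k with
  | zero =>
    have := Complex.Gamma_one_half_eq
    simp only [Nat.cast_zero, zero_add, this]
    simp [Real.sqrt_eq_rpow, Complex.ofReal_cpow Real.pi_pos.le]
  | succ k ih =>
    have h0 := k_half_ne k
    have h := Complex.one_div_Gamma_eq_self_mul_one_div_Gamma_add_one ((k:ℂ) + 1/2)
    have e : ((k+1 : ℕ):ℂ) + 1/2 = (k:ℂ) + 1/2 + 1 := by push_cast; ring
    rw [ih] at h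
    rw [e]; apply mul_left_cancel₀ h0; rw [← h, rgamma_step]

lemma rgamma_deriv (k : ℕ) : HasDerivAt (fun s => (Complex.Gamma s)⁻¹)
    (4 ^ k * (k.factorial : ℂ) / ((Real.sqrt Real.pi : ℂ) * ((2*k).factorial : ℂ)) *
      (Real.eulerMascheroniConstant + 2 * Complex.log 2 - 2 * ∑ j ∈ Finset.range k, 1 / (2 * (j:ℂ) + 1)))
    ((k:ℂ) + 1/2) := by
  have hd : ∀ s, HasDerivAt (fun s => (Complex.Gamma s)⁻¹) (deriv (fun s => (Complex.Gamma s)⁻¹) s) s :=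
    fun s => (Complex.differentiable_one_div_Gamma s).hasDerivAt
  induction k with
  | zero =>
    have h := Complex.hasDerivAt_Gamma_one_half.inv (by
      rw [Complex.Gamma_one_half_eq]; simp [Real.pi_ne_zero])
    have h2 := rgamma_val 0
    simp only [Nat.cast_zero, zero_add] at h2 ⊢
    refine HasDerivAt.congr_deriv (f := fun s => (Complex.Gamma s)⁻¹) h ?_
    rw [div_eq_mul_inv, ← inv_pow, h2]
    have := sqrtpi_ne
    simp
    field_simp
  | succ k ih =>
    have h0 := k_half_ne k
    have e : ((k+1 : ℕ):ℂ) + 1/2 = (k:ℂ) + 1/2 + 1 := by push_cast; ring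
    have hv := rgamma_val (k+1)
    have h1 := hd (((k+1 : ℕ):ℂ) + 1/2)
    set D := deriv (fun s => (Complex.Gamma s)⁻¹) (((k+1 : ℕ):ℂ) + 1/2) with hD
    have h2 : HasDerivAt (fun s => (Complex.Gamma s)⁻¹)
        (1 * (Complex.Gamma (((k+1:ℕ):ℂ) + 1/2))⁻¹ + ((k:ℂ)+1/2) * D) ((k:ℂ) + 1/2) := by
      have h3 : HasDerivAt (fun s => (Complex.Gamma (s+1))⁻¹) D ((k:ℂ)+1/2) := by
        rw [e] at h1
        exact h1.comp_add_const _ _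
      have h4 := (hasDerivAt_id ((k:ℂ)+1/2)).mul h3
      rw [e]
      refine h4.congr_of_eventuallyEq (Filter.Eventually.of_forall fun s => ?_)
      exact Complex.one_div_Gamma_eq_self_mul_one_div_Gamma_add_one s
    have h5 := ih.unique h2
    rw [hv] at h5
    convert h1 using 1
    apply mul_left_cancel₀ h0
    rw [← rgamma_step k] at h5
    rw [Finset.sum_range_succ]
    have h6 : ((k:ℂ)+1/2) * (2 * (1 / (2*(k:ℂ)+1))) = 1 := by
      have := two_k_ne k
      rw [show (k:ℂ) + 1/2 = (2*k+1)/2 by ring]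
      field_simp
    linear_combination h5 - (4 ^ (k+1) * ((k+1).factorial : ℂ) / ((Real.sqrt Real.pi : ℂ) * ((2*(k+1)).factorial : ℂ))) * h6

lemma rgamma_bound : ∃ M : ℝ, 0 ≤ M ∧ ∀ (k : ℕ) (s : ℂ), ‖s - 1/2‖ < 1/4 →
    ‖(Complex.Gamma (s + k))⁻¹‖ ≤ M * 4 ^ k := by
  obtain ⟨M, hM⟩ := (isCompact_closedBall (1/2 : ℂ) (1/4)).exists_bound_of_continuousOn
    (f := fun s => (Complex.Gamma s)⁻¹) Complex.differentiable_one_div_Gamma.continuous.continuousOn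
  refine ⟨M, (norm_nonneg _).trans (hM (1/2) (by simp)), fun k s hs => ?_⟩
  induction k with
  | zero => 
    simpa using hM s (by simpa [dist_eq_norm] using hs.le)
  | succ k ih =>
    have h := Complex.one_div_Gamma_eq_self_mul_one_div_Gamma_add_one (s + k)
    rw [h, norm_mul] at ih
    have h1 : 1/4 ≤ ‖s + k‖ := by
      refine le_trans ?_ (Complex.re_le_norm _)
      have := (Complex.abs_re_le_norm (s - 1/2)).trans hs.le
      have h2 := (abs_le.mp this).1
      simp at h2 ⊢
      have : (0:ℝ) ≤ k := k.cast_nonneg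
      linarith
    rw [show s + ((k+1:ℕ):ℂ) = s + k + 1 by push_cast; ring, pow_succ]
    have := norm_nonneg (Complex.Gamma (s + k + 1))⁻¹
    nlinarith

noncomputable def cc (N : ℕ) : ℂ := ∑ n ∈ Finset.range (N+1), (N.choose n : ℂ) * (-2) ^ n / n

lemma cc_succ (N : ℕ) : cc (N+1) = cc N + ((-1)^(N+1) - 1) / (N+1) := by
  have hN : (N + 1 : ℂ) ≠ 0 := by exact_mod_cast Nat.succ_ne_zero N
  have h1 : cc (N+1) = ∑ m ∈ Finset.range (N+1), ((N+1).choose (m+1) : ℂ) * (-2) ^ (m+1) / ((m:ℂ)+1) := by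
    rw [cc, Finset.sum_range_succ']; simp
  have h2 : cc N = ∑ m ∈ Finset.range (N+1), (N.choose (m+1) : ℂ) * (-2) ^ (m+1) / ((m:ℂ)+1) := by
    rw [cc, Finset.sum_range_succ', Finset.sum_range_succ _ N]; simp
  have h3 : ((-1:ℂ))^(N+1) = ∑ m ∈ Finset.range (N+1), ((N+1).choose (m+1) : ℂ) * (-2) ^ (m+1) + 1 := by
    have := add_pow (-2:ℂ) 1 (N+1)
    rw [show (-2:ℂ)+1 = -1 by norm_num] at this
    rw [this, Finset.sum_range_succ']
    simp [mul_comm]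
  rw [h1, h2, h3, add_sub_cancel_right, Finset.sum_div, ← Finset.sum_add_distrib]
  refine Finset.sum_congr rfl fun m _ => ?_
  have hm : (m + 1 : ℂ) ≠ 0 := by exact_mod_cast Nat.succ_ne_zero m
  have h4 : ((N:ℂ)+1) * (N.choose m) = ((N+1).choose (m+1)) * (m+1) := by
    exact_mod_cast Nat.add_one_mul_choose_eq N m
  have h5 : ((N+1).choose (m+1) : ℂ) = N.choose m + N.choose (m+1) := by
    exact_mod_cast Nat.choose_succ_succ N m
  field_simp
  rw [h5] at h4 ⊢
  linear_combination h4

lemma cc_even (k : ℕ) : cc (2*k) = -2 * ∑ j ∈ Finset.range k, 1 / (2 * (j:ℂ) + 1) := by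
  induction k with
  | zero => simp [cc]
  | succ k ih =>
    rw [show 2*(k+1) = 2*k+1+1 by ring, cc_succ, cc_succ, ih, Finset.sum_range_succ]
    have : (-1:ℂ)^(2*k) = 1 := by simp [pow_mul]
    simp only [pow_succ, this]
    push_cast
    ring

noncomputable def EE (w : ℂ) : ℂ := ∑' n : ℕ, w ^ n / (n * n.factorial)

lemma EE_summable (w : ℂ) : Summable fun n : ℕ => ‖w ^ n / (n * n.factorial)‖ := by
  refine Summable.of_nonneg_of_le (fun _ => norm_nonneg _) (fun n => ?_) (Real.summable_pow_div_factorial ‖w‖)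
  rcases Nat.eq_zero_or_pos n with rfl | hn
  · simp
  · rw [norm_div, norm_pow, norm_mul, Complex.norm_natCast, Complex.norm_natCast]
    have h1 : (1:ℝ) ≤ n := by exact_mod_cast hn
    have h2 : (0:ℝ) < n.factorial := by positivity
    gcongr
    nlinarith

lemma EE_exp (w : ℂ) : HasSum (fun n : ℕ => (-w) ^ n / n.factorial * cc n) (EE (2*w) * exp (-w)) := by
  have hg : Summable fun n : ℕ => ‖(-w)^n / (n.factorial : ℂ)‖ := by
    simpa using Real.summable_pow_div_factorial ‖w‖
  have h := hasSum_sum_range_mul_of_summable_norm (EE_summable (2*w)) hg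
  rw [EE, Complex.exp_eq_exp_ℂ, NormedSpace.exp_eq_tsum_div]
  refine (hasSum_congr_aux fun n => ?_).mpr h
  rw [cc, Finset.mul_sum]
  refine Finset.sum_congr rfl fun k hk => ?_
  have hk : k ≤ n := Nat.lt_succ_iff.mp (Finset.mem_range.mp hk)
  obtain ⟨m, rfl⟩ := Nat.exists_eq_add_of_le hk
  rw [Nat.cast_add_choose, Nat.add_sub_cancel_left]
  have h1 : ((k+m).factorial : ℂ) ≠ 0 := by exact_mod_cast Nat.factorial_ne_zero _
  have h2 : (k.factorial : ℂ) ≠ 0 := by exact_mod_cast Nat.factorial_ne_zero _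
  have h3 : (m.factorial : ℂ) ≠ 0 := by exact_mod_cast Nat.factorial_ne_zero _
  have h4 : (-w)^(k+m) * (-2)^k = (2*w)^k * (-w)^m := by
    rw [pow_add, mul_right_comm, ← mul_pow]; ring
  rcases eq_or_ne (k:ℂ) 0 with h0 | h0
  · simp [h0]
  field_simp
  linear_combination h4

lemma EE_split (ε x : ℂ) (hε : ε ^ 2 = -1) : EE (ε * x) =
    (∑' n : ℕ, (-1) ^ (n + 1) * x ^ (2 * (n + 1)) /
      ((2 * ((n : ℂ) + 1)) * ((2 * (n + 1)).factorial : ℂ))) +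
    ε * ∑' n : ℕ, (-1) ^ n * x ^ (2 * n + 1) / ((2 * (n : ℂ) + 1) * ((2 * n + 1).factorial : ℂ)) := by
  have hp : ∀ n : ℕ, ε ^ (2 * n) = (-1) ^ n := fun n => by rw [pow_mul, hε]
  obtain ⟨f, hf⟩ : ∃ f : ℕ → ℂ, ∀ n, f n = (ε * x) ^ n / (n * n.factorial) := ⟨_, fun _ => rfl⟩
  have hs : Summable f := by
    rw [funext hf]; exact (EE_summable (ε * x)).of_norm
  have he : Summable fun n : ℕ => f (2 * n) :=
    hs.comp_injective (i := fun n : ℕ => 2 * n) (fun a b h => by simpa using h)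
  have ho : Summable fun n : ℕ => f (2 * n + 1) :=
    hs.comp_injective (i := fun n : ℕ => 2 * n + 1) (fun a b h => by simpa using h)
  have h0 : f (2 * 0) = 0 := by rw [hf]; simp
  have hE : EE (ε * x) = ∑' n, f n := by rw [EE, funext hf]
  rw [hE, ← tsum_even_add_odd he ho, he.tsum_eq_zero_add, h0, zero_add, ← tsum_mul_left]
  have h1 : ∀ n : ℕ, f (2 * (n + 1)) = (-1) ^ (n + 1) * x ^ (2 * (n + 1)) /
      ((2 * ((n : ℂ) + 1)) * ((2 * (n + 1)).factorial : ℂ)) := by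
    intro n
    rw [hf, mul_pow, hp, Nat.cast_mul, Nat.cast_add, Nat.cast_one, Nat.cast_two]
  have h2 : ∀ n : ℕ, f (2 * n + 1) = ε * ((-1) ^ n * x ^ (2 * n + 1) /
      ((2 * (n : ℂ) + 1) * ((2 * n + 1).factorial : ℂ))) := by
    intro n
    rw [hf, mul_pow, pow_succ ε, hp, Nat.cast_add, Nat.cast_mul, Nat.cast_one, Nat.cast_two]
    ring
  rw [tsum_congr h1, tsum_congr h2]

lemma main_id (z : ℂ) : HasSum (fun k : ℕ => (-1) ^ k * z ^ (2*k) / (2*k).factorial *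
      (-2 * ∑ j ∈ Finset.range k, 1 / (2 * (j:ℂ) + 1)))
    ((∑' n : ℕ, (-1) ^ (n + 1) * (2*z) ^ (2 * (n + 1)) /
      ((2 * ((n : ℂ) + 1)) * ((2 * (n + 1)).factorial : ℂ))) * cos z +
    (∑' n : ℕ, (-1) ^ n * (2*z) ^ (2 * n + 1) / ((2 * (n : ℂ) + 1) * ((2 * n + 1).factorial : ℂ))) * sin z) := by
  have h1 := EE_split I (2*z) I_sq
  have h2 := EE_split (-I) (2*z) (by rw [neg_sq, I_sq])
  set C := (∑' n : ℕ, (-1) ^ (n + 1) * (2*z) ^ (2 * (n + 1)) /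
      ((2 * ((n : ℂ) + 1)) * ((2 * (n + 1)).factorial : ℂ)))
  set S := ∑' n : ℕ, (-1) ^ n * (2*z) ^ (2 * n + 1) / ((2 * (n : ℂ) + 1) * ((2 * n + 1).factorial : ℂ))
  have h3 := ((EE_exp (I*z)).add (EE_exp (-I*z))).div_const 2
  rw [show 2 * (I*z) = I * (2*z) by ring, show 2 * (-I*z) = -I * (2*z) by ring, h1, h2,
    show -(I*z) = (-z)*I by ring, show -(-I*z) = z*I by ring, Complex.exp_mul_I, Complex.exp_mul_I,
    Complex.cos_neg, Complex.sin_neg] at h3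
  have h4 : ((C + I * S) * (cos z + -sin z * I) + (C + -I * S) * (cos z + sin z * I)) / 2
      = C * cos z + S * sin z := by
    linear_combination (- S * sin z) * I_sq
  rw [h4] at h3
  have hinj : Function.Injective (fun k : ℕ => 2 * k) := fun a b h => by simpa using h
  rw [← hinj.hasSum_iff] at h3
  · refine (hasSum_congr_aux fun k => ?_).mp h3
    have e1 : (-z*I)^(2*k) = (-1)^k * z^(2*k) := by
      rw [mul_pow, pow_mul I, I_sq, pow_mul, neg_sq, ← pow_mul, mul_comm]
    have e2 : (z*I)^(2*k) = (-1)^k * z^(2*k) := by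
      rw [mul_pow, pow_mul I, I_sq, mul_comm]
    simp only [Function.comp]
    rw [e1, e2, ← cc_even]; ring
  · intro n hn
    have : Odd n := by
      rw [← Nat.not_even_iff_odd]
      rintro ⟨m, rfl⟩
      exact hn ⟨m, by simp; ring⟩
    rw [show -z * I = -(z*I) by ring, this.neg_pow]; ring

lemma deriv_series (z : ℂ) :
    let F : ℂ → ℂ := fun ν => ∑' k : ℕ, (-1) ^ k * (z ^ 2 / 4) ^ k / ((k.factorial : ℂ) * Complex.Gamma (ν + k + 1))
    DifferentiableAt ℂ F (-1/2) ∧ F (-1/2) = cos z / (Real.sqrt Real.pi : ℂ) ∧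
    HasSum (fun k : ℕ => (-1) ^ k * z ^ (2*k) / (2*k).factorial *
      (Real.eulerMascheroniConstant + 2 * Complex.log 2 - 2 * ∑ j ∈ Finset.range k, 1 / (2 * (j:ℂ) + 1)) / (Real.sqrt Real.pi : ℂ))
      (deriv F (-1/2)) := by
  intro F
  obtain ⟨M, hM0, hM⟩ := rgamma_bound
  let f : ℕ → ℂ → ℂ := fun k ν => (-1) ^ k * (z ^ 2 / 4) ^ k / ((k.factorial : ℂ) * Complex.Gamma (ν + k + 1))
  let U : Set ℂ := Metric.ball (-1/2) (1/4)
  have hf : ∀ k ν, f k ν = ((-1) ^ k * (z ^ 2 / 4) ^ k / (k.factorial : ℂ)) * (Complex.Gamma (ν + k + 1))⁻¹ := by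
    intro k ν; simp only [f]; rw [div_mul_eq_div_div, div_eq_mul_inv _ (Gamma _)]
  have hu : Summable fun k : ℕ => M * (‖z^2‖ ^ k / k.factorial) :=
    (Real.summable_pow_div_factorial _).mul_left _
  have hd : ∀ k, Differentiable ℂ (f k) := by
    intro k
    rw [show f k = _ from funext (hf k)]
    refine Differentiable.const_mul ?_ _
    exact Complex.differentiable_one_div_Gamma.comp (f := fun ν : ℂ => ν + k + 1) (by fun_prop)
  have hb : ∀ (k : ℕ) (ν : ℂ), ν ∈ U → ‖f k ν‖ ≤ M * (‖z^2‖ ^ k / k.factorial) := by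
    intro k ν hν
    have h1 := hM k (ν + 1) (by
      have := mem_ball_iff_norm.mp hν
      rw [show ν + 1 - 1/2 = ν - -1/2 by ring]; exact this)
    rw [hf, norm_mul, show ν + k + 1 = ν + 1 + k by ring]
    refine (mul_le_mul_of_nonneg_left h1 (norm_nonneg _)).trans (le_of_eq ?_)
    simp only [norm_div, norm_mul, norm_pow, norm_neg, norm_one, one_pow, one_mul, Complex.norm_natCast, div_pow, Complex.norm_ofNat]
    field_simp
  have hmem : (-1/2 : ℂ) ∈ U := Metric.mem_ball_self (by norm_num)
  have hU : IsOpen U := Metric.isOpen_ball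
  have key : ∀ k : ℕ, ((-1) ^ k * (z ^ 2 / 4) ^ k / (k.factorial : ℂ)) *
      (4 ^ k * (k.factorial : ℂ) / ((Real.sqrt Real.pi : ℂ) * ((2*k).factorial : ℂ))) =
      (-1) ^ k * z ^ (2*k) / (2*k).factorial / (Real.sqrt Real.pi : ℂ) := by
    intro k
    have := sqrtpi_ne
    have h2 : (k.factorial : ℂ) ≠ 0 := by exact_mod_cast Nat.factorial_ne_zero _
    have h3 : ((2*k).factorial : ℂ) ≠ 0 := by exact_mod_cast Nat.factorial_ne_zero _
    rw [div_pow, ← pow_mul]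
    field_simp
  have earg : ∀ k : ℕ, (-1/2 : ℂ) + k + 1 = k + 1/2 := fun k => by ring
  refine ⟨?_, ?_, ?_⟩
  · exact (differentiableOn_tsum_of_summable_norm hu (fun i => (hd i).differentiableOn) hU hb).differentiableAt
      (hU.mem_nhds hmem)
  · have h := (Complex.hasSum_cos z).div_const (Real.sqrt Real.pi : ℂ)
    rw [← h.tsum_eq]
    refine tsum_congr fun k => ?_
    change f k (-1/2) = _
    rw [hf, earg, rgamma_val, key]
  · have h := hasSum_deriv_of_summable_norm hu (fun i => (hd i).differentiableOn) hU hb hmem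
    refine (hasSum_congr_aux fun k => ?_).mp h
    have h1 := rgamma_deriv k
    rw [← earg, add_assoc] at h1
    have h2 := (h1.comp_add_const (-1/2 : ℂ) ((k:ℂ)+1)).const_mul ((-1) ^ k * (z ^ 2 / 4) ^ k / (k.factorial : ℂ))
    have h3 : f k = fun ν => ((-1) ^ k * (z ^ 2 / 4) ^ k / (k.factorial : ℂ)) * (Complex.Gamma (ν + (k + 1)))⁻¹ := by
      funext ν; rw [hf, add_assoc]
    rw [h3, h2.deriv, ← mul_assoc, key]
    ring


theorem stmt7 (z : ℂ) (hz : z ∉ Complex.ofReal '' Set.Iic (0 : ℝ)) :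
    deriv (fun ν : ℂ => sphBesselJ ν z) (-1) =
      (cosIntegral (2 * z) * Complex.cos z + sinIntegral (2 * z) * Complex.sin z) / z := by
  have hsl : z ∈ slitPlane := by
    rw [mem_slitPlane_iff]
    by_contra! h
    exact hz ⟨z.re, h.1, by apply Complex.ext <;> simp [h.2]⟩
  have hz0 : z ≠ 0 := slitPlane_ne_zero hsl
  obtain ⟨hF, hF0, hF1⟩ := deriv_series z
  set F : ℂ → ℂ := fun ν => ∑' k : ℕ, (-1) ^ k * (z ^ 2 / 4) ^ k / ((k.factorial : ℂ) * Complex.Gamma (ν + k + 1)) with hFdef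
  have hpi := sqrtpi_ne
  -- value of the derivative of the series
  have hsum := main_id z
  have hcos := (Complex.hasSum_cos z).mul_right (Real.eulerMascheroniConstant + 2 * Complex.log 2)
  have hadd := (hcos.add hsum).div_const (Real.sqrt Real.pi : ℂ)
  have hF2 := hF1.unique ((hasSum_congr_aux fun k => by ring).mp hadd)
  have e12 : (-1 : ℂ) + 1/2 = -1/2 := by norm_num
  have hD : HasDerivAt (fun ν : ℂ => sphBesselJ ν z)
      (((Real.pi : ℂ) / (2 * z)) ^ ((1 : ℂ) / 2) *
        ((z/2)^(-1/2 : ℂ) * log (z/2) * F (-1/2) + (z/2)^(-1/2 : ℂ) * deriv F (-1/2))) (-1) := by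
    have h1 : HasDerivAt (fun ν : ℂ => (z/2)^ν) ((z/2)^(-1/2 : ℂ) * log (z/2)) (-1/2) := by
      simpa using (hasDerivAt_id (-1/2 : ℂ)).const_cpow (c := z/2) (Or.inl (by simpa using hz0))
    have h2 := h1.mul hF.hasDerivAt
    rw [← e12] at h2
    rw [← e12]
    exact (h2.comp_add_const (-1 : ℂ) (1/2)).const_mul _
  rw [hD.deriv, hF0, hF2]
  have hl2 : ((Real.log 2 : ℝ) : ℂ) = log 2 := Complex.ofNat_log
  have hlogz2 : log (z/2) = log z - log 2 := by
    have := log_ofReal_mul (r := 1/2) (by norm_num) hz0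
    rw [show z/2 = ((1/2 : ℝ) : ℂ) * z by push_cast; ring, this]
    rw [one_div, Real.log_inv]; push_cast; rw [hl2]; ring
  have hlog2z : log (2*z) = log z + log 2 := by
    have := log_ofReal_mul (r := 2) (by norm_num) hz0
    push_cast at this
    rw [this, hl2]; ring
  have hpre : ((Real.pi : ℂ) / (2 * z)) ^ ((1 : ℂ) / 2) * (z/2)^(-1/2 : ℂ) = (Real.sqrt Real.pi : ℂ) / z := by
    have hl : log ((Real.pi : ℂ) / (2 * z)) = (Real.log Real.pi : ℂ) - log z - log 2 := by
      have h1 := log_ofReal_mul (r := Real.pi / 2) (by positivity) (inv_ne_zero hz0)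
      rw [show (Real.pi : ℂ) / (2 * z) = ((Real.pi/2 : ℝ) : ℂ) * z⁻¹ by push_cast; field_simp, h1,
        log_inv _ (slitPlane_arg_ne_pi hsl), Real.log_div Real.pi_ne_zero (by norm_num)]
      push_cast; rw [hl2]; ring
    have hne : (Real.pi : ℂ) / (2 * z) ≠ 0 :=
      div_ne_zero (by exact_mod_cast Real.pi_ne_zero) (mul_ne_zero two_ne_zero hz0)
    rw [cpow_def_of_ne_zero hne, cpow_def_of_ne_zero (div_ne_zero hz0 two_ne_zero), ← exp_add, hl, hlogz2,
      show ((Real.log Real.pi : ℂ) - log z - log 2) * (1/2) + (log z - log 2) * (-1/2)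
        = ((Real.log Real.pi * (1/2) : ℝ) : ℂ) - log z by push_cast; ring, exp_sub, exp_log hz0,
      Real.sqrt_eq_rpow, Real.rpow_def_of_pos Real.pi_pos, ofReal_exp]
  rw [cosIntegral, sinIntegral, hlog2z]
  rw [show ∀ a b c d e : ℂ, a * (b * c * d + b * e) = (a * b) * (c * d + e) by intros; ring, hpre, hlogz2]
  field_simp
  ring
end

section
/- For every z ∈ ℂ with z ∉ (-∞,0], the derivative at ν = 1/2 of the map ν ↦ K_ν(z) equals √(π/(2z)) · E₁(2z) · e^{z}, and the derivative at ν = −1/2 of the same map equals −√(π/(2z)) · E₁(2z) · e^{z}, where the square root is the principal branch. -/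
open Complex

/-- The modified Bessel function of the second kind
`K_ν(z) = (π/2) (I_{−ν}(z) − I_ν(z)) / sin(νπ)` (for `ν ∉ ℤ`). -/
noncomputable def besselK (ν z : ℂ) : ℂ :=
  ((Real.pi : ℂ) / 2) * (besselI (-ν) z - besselI ν z) / Complex.sin (ν * Real.pi)

lemma aux_rec (s : ℂ) : (Gamma s)⁻¹ = s * (Gamma (s + 1))⁻¹ :=
  Complex.one_div_Gamma_eq_self_mul_one_div_Gamma_add_one s

lemma aux_half_ne (k : ℕ) : ((k : ℂ) + 1 / 2) ≠ 0 := by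
  intro h
  have := congrArg Complex.re h
  simp at this
  have : (0 : ℝ) ≤ k := k.cast_nonneg
  linarith

lemma aux_sqrt_pi_ne : ((√Real.pi : ℝ) : ℂ) ≠ 0 := by
  rw [Complex.ofReal_ne_zero]; exact (Real.sqrt_pos.mpr Real.pi_pos).ne'

lemma aux_gamma_half : Gamma (1 / 2) = ((√Real.pi : ℝ) : ℂ) := by
  have := Complex.Gamma_ofReal (1 / 2)
  rw [Real.Gamma_one_half_eq] at this
  rw [← this]; push_cast; rfl

/-- values of 1/Γ at half integers -/
lemma aux_val (k : ℕ) : (Gamma ((k : ℂ) + 1 / 2))⁻¹ =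
    4 ^ k * (k.factorial : ℂ) / (((2 * k).factorial : ℂ) * (√Real.pi : ℝ)) := by
  induction k with
  | zero => simp [← aux_gamma_half]
  | succ k ih =>
    have h1 := aux_rec ((k : ℂ) + 1 / 2)
    have hne := aux_half_ne k
    rw [ih] at h1
    have e : ((k + 1 : ℕ) : ℂ) + 1 / 2 = (k : ℂ) + 1 / 2 + 1 := by push_cast; ring
    rw [e]
    have h2 : (Gamma ((k : ℂ) + 1 / 2 + 1))⁻¹ =
      4 ^ k * (k.factorial : ℂ) / (((2 * k).factorial : ℂ) * (√Real.pi : ℝ)) / ((k : ℂ) + 1 / 2) := by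
      rw [h1, mul_div_cancel_left₀ _ hne]
    rw [h2, show 2 * (k + 1) = 2 * k + 1 + 1 by ring, Nat.factorial_succ, Nat.factorial_succ,
      Nat.factorial_succ]
    push_cast
    have hp := aux_sqrt_pi_ne
    have hf : ((2 * k).factorial : ℂ) ≠ 0 := by exact_mod_cast Nat.factorial_ne_zero _
    have h3 : (2 * (k : ℂ) + 1) ≠ 0 := by exact_mod_cast Nat.succ_ne_zero (2 * k)
    have h4 : (2 * (k : ℂ) + 1 + 1) ≠ 0 := by exact_mod_cast Nat.succ_ne_zero (2 * k + 1)
    have h5 : (k : ℂ) + 1 / 2 = (2 * k + 1) / 2 := by ring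
    rw [h5]
    field_simp
    ring

/-- the digamma values at half integers -/
noncomputable def auxC (k : ℕ) : ℂ :=
  -(Real.eulerMascheroniConstant : ℂ) - 2 * Complex.log 2 +
    2 * ∑ j ∈ Finset.range k, 1 / (2 * (j : ℂ) + 1)

lemma aux_diff : Differentiable ℂ (fun s : ℂ => (Gamma s)⁻¹) :=
  Complex.differentiable_one_div_Gamma

lemma aux_deriv (k : ℕ) : HasDerivAt (fun s : ℂ => (Gamma s)⁻¹)
    (-auxC k * (Gamma ((k : ℂ) + 1 / 2))⁻¹) ((k : ℂ) + 1 / 2) := by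
  induction k with
  | zero =>
    have h := Complex.hasDerivAt_Gamma_one_half
    have hp := aux_sqrt_pi_ne
    have h2 := h.inv (by rw [aux_gamma_half]; exact hp)
    simp only [Nat.cast_zero, zero_add]
    refine h2.congr_deriv ?_
    rw [aux_gamma_half]
    simp only [auxC, Finset.range_zero, Finset.sum_empty]
    field_simp
    ring
  | succ k ih =>
    have hne := aux_half_ne k
    have e : ((k + 1 : ℕ) : ℂ) + 1 / 2 = (k : ℂ) + 1 / 2 + 1 := by push_cast; ring
    rw [e]
    set s : ℂ := (k : ℂ) + 1 / 2 with hs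
    have hd := (aux_diff (s + 1)).hasDerivAt
    set d := deriv (fun s : ℂ => (Gamma s)⁻¹) (s + 1) with hdd
    have h1 : HasDerivAt (fun t : ℂ => t * (Gamma (t + 1))⁻¹)
        (1 * (Gamma (s + 1))⁻¹ + s * d) s :=
      (hasDerivAt_id s).mul (hd.comp_add_const s 1)
    have h2 : (fun t : ℂ => t * (Gamma (t + 1))⁻¹) = fun t : ℂ => (Gamma t)⁻¹ := by
      funext t; exact (aux_rec t).symm
    rw [h2] at h1
    have h3 := h1.unique ih
    rw [aux_rec s] at h3
    refine hd.congr_deriv ?_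
    have h4 : auxC (k + 1) = auxC k + 1 / s := by
      have h5 : s = (2 * k + 1) / 2 := by rw [hs]; ring
      have h6 : (2 * (k : ℂ) + 1) ≠ 0 := by exact_mod_cast Nat.succ_ne_zero (2 * k)
      rw [auxC, auxC, Finset.sum_range_succ, h5]
      field_simp
      ring
    rw [h4]
    apply mul_left_cancel₀ hne
    field_simp
    linear_combination h3

/-- the series part -/
noncomputable def auxF (w ν : ℂ) : ℂ :=
  ∑' k : ℕ, w ^ k / ((k.factorial : ℂ) * Complex.Gamma (ν + k + 1))

lemma aux_series (w ν : ℂ) (hν : -(3 / 4) < ν.re) (hν1 : ‖ν‖ < 1) :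
    DifferentiableAt ℂ (auxF w) ν ∧
    HasSum (fun k : ℕ => w ^ k / (k.factorial : ℂ) *
      deriv (fun s : ℂ => (Gamma s)⁻¹) (ν + k + 1)) (deriv (auxF w) ν) := by
  obtain ⟨C, hC⟩ := (isCompact_closedBall (0 : ℂ) 1).exists_bound_of_continuousOn
    (f := fun ν : ℂ => (Gamma (ν + 1))⁻¹)
    (aux_diff.continuous.comp (continuous_id.add continuous_const)).continuousOn
  let U : Set ℂ := {ν : ℂ | -(3 / 4) < ν.re} ∩ Metric.ball 0 1
  have hU : IsOpen U := (isOpen_lt continuous_const Complex.continuous_re).inter Metric.isOpen_ball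
  have hmem : ν ∈ U := ⟨hν, by simpa using hν1⟩
  have hb : ∀ (k : ℕ) (s : ℂ), s ∈ U → ‖(Gamma (s + k + 1))⁻¹‖ ≤ 4 ^ k * C := by
    intro k s hs
    induction k with
    | zero => simpa using hC s (Metric.ball_subset_closedBall hs.2)
    | succ k ih =>
      have h1 := aux_rec (s + k + 1)
      have h2 : (1 / 4 : ℝ) ≤ ‖s + k + 1‖ := by
        refine le_trans ?_ (Complex.re_le_norm _)
        have h3 : -(3 / 4) < s.re := hs.1
        have : (0 : ℝ) ≤ k := k.cast_nonneg
        simp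
        linarith
      rw [h1, norm_mul] at ih
      have e : s + ((k + 1 : ℕ) : ℂ) + 1 = s + k + 1 + 1 := by push_cast; ring
      rw [e, pow_succ]
      nlinarith [norm_nonneg ((Gamma (s + k + 1 + 1))⁻¹)]
  let F : ℕ → ℂ → ℂ := fun k ν => w ^ k / ((k.factorial : ℂ) * Complex.Gamma (ν + k + 1))
  have hFeq : ∀ k, F k = fun ν => w ^ k / (k.factorial : ℂ) * (Gamma (ν + (k + 1)))⁻¹ := by
    intro k; funext t; simp only [F]; rw [add_assoc]; rw [div_mul_eq_div_div, div_eq_mul_inv]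
  have hFd : ∀ k s, HasDerivAt (F k) (w ^ k / (k.factorial : ℂ) *
      deriv (fun s : ℂ => (Gamma s)⁻¹) (s + k + 1)) s := by
    intro k s
    rw [hFeq, add_assoc]
    exact ((aux_diff (s + (k + 1))).hasDerivAt.comp_add_const s ((k : ℂ) + 1)).const_mul _
  have hu : Summable (fun k : ℕ => (‖w‖ * 4) ^ k / (k.factorial : ℝ) * C) :=
    (Real.summable_pow_div_factorial _).mul_right C
  have hle : ∀ (k : ℕ) (s : ℂ), s ∈ U → ‖F k s‖ ≤ (‖w‖ * 4) ^ k / (k.factorial : ℝ) * C := by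
    intro k s hs
    rw [hFeq]
    beta_reduce
    rw [← add_assoc, norm_mul, norm_div, norm_pow, Complex.norm_natCast, mul_pow]
    calc _ ≤ ‖w‖ ^ k / (k.factorial : ℝ) * (4 ^ k * C) := by gcongr; exact hb k s hs
      _ = _ := by ring
  have hdo : ∀ k, DifferentiableOn ℂ (F k) U :=
    fun k s _ => (hFd k s).differentiableAt.differentiableWithinAt
  have r1 := Complex.differentiableOn_tsum_of_summable_norm hu hdo hU hle
  have r2 := Complex.hasSum_deriv_of_summable_norm hu hdo hU hle hmem
  refine ⟨r1.differentiableAt (hU.mem_nhds hmem), ?_⟩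
  simp_rw [fun k => (hFd k ν).deriv] at r2
  exact r2

/-- the coefficient identity -/
lemma aux_coef (n : ℕ) : ∑ m ∈ Finset.range (n + 1), (n.choose m : ℂ) * (-((-2) ^ m / (m : ℂ))) =
    2 * ∑ j ∈ Finset.range ((n + 1) / 2), 1 / (2 * (j : ℂ) + 1) := by
  induction n with
  | zero => simp
  | succ n ih =>
    have hn : ((n : ℂ) + 1) ≠ 0 := by exact_mod_cast Nat.succ_ne_zero n
    have key : ∑ m ∈ Finset.range (n + 1 + 1), ((n + 1).choose m : ℂ) * (-((-2) ^ m / (m : ℂ))) =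
        ∑ m ∈ Finset.range (n + 1), (n.choose m : ℂ) * (-((-2) ^ m / (m : ℂ))) +
        (1 - (-1) ^ (n + 1)) / (n + 1) := by
      have h1 : (-1 : ℂ) ^ (n + 1) = ∑ m ∈ Finset.range (n + 1 + 1),
          (-2 : ℂ) ^ m * ((n + 1).choose m : ℂ) := by
        have := add_pow (-2 : ℂ) 1 (n + 1)
        simp only [one_pow, mul_one] at this
        rw [← this]; norm_num
      rw [Finset.sum_range_succ'] at h1
      have h2 : ∑ m ∈ Finset.range (n + 1), (n.choose m : ℂ) * (-((-2) ^ m / (m : ℂ))) =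
          ∑ m ∈ Finset.range (n + 1 + 1), (n.choose m : ℂ) * (-((-2) ^ m / (m : ℂ))) := by
        rw [Finset.sum_range_succ _ (n + 1)]; simp
      rw [h2, Finset.sum_range_succ', Finset.sum_range_succ' _ (n + 1), h1]
      simp only [pow_zero, Nat.choose_zero_right, Nat.cast_one, mul_one, Nat.cast_zero, div_zero,
        neg_zero, mul_zero, add_zero]
      rw [sub_add_eq_sub_sub_swap, sub_self, zero_sub, neg_div, Finset.sum_div,
        ← sub_eq_add_neg, ← Finset.sum_sub_distrib]
      refine Finset.sum_congr rfl fun m _ => ?_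
      have hm : ((m : ℂ) + 1) ≠ 0 := by exact_mod_cast Nat.succ_ne_zero m
      have h3 : ((n + 1).choose (m + 1) : ℂ) * (m + 1) = (n + 1) * n.choose m := by
        exact_mod_cast (Nat.add_one_mul_choose_eq n m).symm
      have h4 : ((n + 1).choose (m + 1) : ℂ) = n.choose m + n.choose (m + 1) := by
        exact_mod_cast Nat.choose_succ_succ n m
      push_cast
      have h5 : (n.choose (m + 1) : ℂ) = ((n + 1).choose (m + 1) : ℂ) - n.choose m := by
        rw [h4]; ring
      rw [h5]
      field_simp
      linear_combination h3
    rw [key, ih]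
    rcases Nat.even_or_odd' n with ⟨k, rfl | rfl⟩
    · rw [show (2 * k + 1) / 2 = k by omega, show (2 * k + 1 + 1) / 2 = k + 1 by omega,
        Finset.sum_range_succ, pow_succ, pow_mul]
      push_cast
      norm_num
      ring
    · rw [show (2 * k + 1 + 1) / 2 = k + 1 by omega, show (2 * k + 1 + 1 + 1) / 2 = k + 1 by omega,
        show 2 * k + 1 + 1 = 2 * (k + 1) by ring, pow_mul]
      norm_num

lemma aux_sum (z : ℂ) : HasSum (fun n : ℕ => auxC ((n + 1) / 2) * (z ^ n / (n.factorial : ℂ)))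
    (Complex.exp z * (-(Real.eulerMascheroniConstant : ℂ) - 2 * Complex.log 2 -
      ∑' n : ℕ, (-1) ^ (n + 1) * (2 * z) ^ (n + 1) / (((n : ℂ) + 1) * ((n + 1).factorial : ℂ)))) := by
  let f : ℕ → ℂ := fun n => z ^ n / (n.factorial : ℂ)
  let g : ℕ → ℂ := fun m => -((-2 * z) ^ m / ((m : ℂ) * (m.factorial : ℂ)))
  have hf : Summable fun n => ‖f n‖ := NormedSpace.norm_expSeries_div_summable z
  have hg : Summable fun n => ‖g n‖ := by
    refine Summable.of_nonneg_of_le (fun _ => norm_nonneg _) (fun m => ?_)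
      (NormedSpace.norm_expSeries_div_summable (-2 * z))
    simp only [g, norm_neg, norm_div, norm_mul, Complex.norm_natCast]
    rcases Nat.eq_zero_or_pos m with rfl | hm
    · simp
    · have h1 : (1 : ℝ) ≤ m := by exact_mod_cast hm
      have h2 : (0 : ℝ) < m.factorial := by exact_mod_cast Nat.factorial_pos m
      gcongr
      nlinarith
  have hfe : HasSum f (Complex.exp z) := by
    rw [Complex.exp_eq_exp_ℂ]; exact NormedSpace.expSeries_div_hasSum_exp z
  have hgs : ∑' n, g n = -∑' n : ℕ, (-1) ^ (n + 1) * (2 * z) ^ (n + 1) /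
      (((n : ℂ) + 1) * ((n + 1).factorial : ℂ)) := by
    rw [hg.of_norm.tsum_eq_zero_add, ← tsum_neg]
    simp only [g, Nat.cast_zero, zero_mul, div_zero, neg_zero, zero_add]
    refine tsum_congr fun n => ?_
    rw [← mul_pow]
    push_cast
    ring_nf
  have hprod := tsum_mul_tsum_eq_tsum_sum_antidiagonal_of_summable_norm hg hf
  have hps := (summable_norm_sum_mul_antidiagonal_of_summable_norm hg hf).of_norm.hasSum
  rw [← hprod, hgs, hfe.tsum_eq] at hps
  have htot := (hfe.mul_left (-(Real.eulerMascheroniConstant : ℂ) - 2 * Complex.log 2)).add hps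
  convert! htot using 1
  · funext n
    rw [auxC, add_mul, ← aux_coef, Finset.Nat.sum_antidiagonal_eq_sum_range_succ
      (fun i j => g i * f j)]
    congr 1
    rw [Finset.sum_mul]
    refine Finset.sum_congr rfl fun m hm => ?_
    have hmn : m ≤ n := Nat.lt_succ_iff.mp (Finset.mem_range.mp hm)
    simp only [f, g]
    rw [Nat.cast_choose ℂ hmn, mul_pow, show z ^ n = z ^ m * z ^ (n - m) by
      rw [← pow_add, Nat.add_sub_cancel' hmn]]
    have h1 : (n.factorial : ℂ) ≠ 0 := by exact_mod_cast Nat.factorial_ne_zero n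
    have h2 : (m.factorial : ℂ) ≠ 0 := by exact_mod_cast Nat.factorial_ne_zero m
    have h3 : ((n - m).factorial : ℂ) ≠ 0 := by exact_mod_cast Nat.factorial_ne_zero (n - m)
    rcases Nat.eq_zero_or_pos m with rfl | hm0
    · simp
    · have h4 : (m : ℂ) ≠ 0 := by exact_mod_cast hm0.ne'
      field_simp
  · ring

lemma aux_t1 (z : ℂ) (k : ℕ) : (z ^ 2 / 4) ^ k / (k.factorial : ℂ) * (Gamma ((k : ℂ) + 1 / 2))⁻¹ =
    (√Real.pi : ℂ)⁻¹ * (z ^ (2 * k) / ((2 * k).factorial : ℂ)) := by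
  have hp := aux_sqrt_pi_ne
  have h2 : (k.factorial : ℂ) ≠ 0 := by exact_mod_cast Nat.factorial_ne_zero k
  have h3 : ((2 * k).factorial : ℂ) ≠ 0 := by exact_mod_cast Nat.factorial_ne_zero (2 * k)
  rw [aux_val, div_pow, pow_mul]
  field_simp

lemma aux_t2 (z : ℂ) (hz : z ≠ 0) (k : ℕ) :
    (z ^ 2 / 4) ^ k / (k.factorial : ℂ) * (Gamma (((k + 1 : ℕ) : ℂ) + 1 / 2))⁻¹ =
    (√Real.pi : ℂ)⁻¹ * (2 / z) * (z ^ (2 * k + 1) / ((2 * k + 1).factorial : ℂ)) := by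
  have hp := aux_sqrt_pi_ne
  have h2 : (k.factorial : ℂ) ≠ 0 := by exact_mod_cast Nat.factorial_ne_zero k
  have h3 : ((2 * k + 1).factorial : ℂ) ≠ 0 := by
    exact_mod_cast Nat.factorial_ne_zero (2 * k + 1)
  have h4 : ((k : ℂ) + 1) ≠ 0 := by exact_mod_cast Nat.succ_ne_zero k
  rw [aux_val, div_pow, pow_succ z (2 * k), pow_mul, show 2 * (k + 1) = 2 * k + 1 + 1 by ring,
    Nat.factorial_succ (2 * k + 1), Nat.factorial_succ k]
  push_cast
  rw [show (2 * (k : ℂ) + 1 + 1) = 2 * (k + 1) by ring]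
  field_simp
  ring

lemma aux_F1 (z : ℂ) : auxF (z ^ 2 / 4) (-(1 / 2)) = (√Real.pi : ℂ)⁻¹ * Complex.cosh z := by
  rw [← ((Complex.hasSum_cosh z).mul_left _).tsum_eq, auxF]
  refine tsum_congr fun k => ?_
  rw [← aux_t1, div_mul_eq_div_div, div_eq_mul_inv _ (Gamma _)]
  congr 3; ring

lemma aux_F2 (z : ℂ) (hz : z ≠ 0) :
    auxF (z ^ 2 / 4) (1 / 2) = (√Real.pi : ℂ)⁻¹ * (2 / z) * Complex.sinh z := by
  rw [← ((Complex.hasSum_sinh z).mul_left _).tsum_eq, auxF]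
  refine tsum_congr fun k => ?_
  rw [← aux_t2 z hz, div_mul_eq_div_div, div_eq_mul_inv _ (Gamma _)]
  congr 3; push_cast; ring

lemma aux_F12' (z : ℂ) (hz : z ≠ 0) :
    deriv (auxF (z ^ 2 / 4)) (-(1 / 2)) + z / 2 * deriv (auxF (z ^ 2 / 4)) (1 / 2) =
    -(√Real.pi : ℂ)⁻¹ * (Complex.exp z *
     (-(Real.eulerMascheroniConstant : ℂ) - 2 * Complex.log 2 -
      ∑' n : ℕ, (-1) ^ (n + 1) * (2 * z) ^ (n + 1) /
        (((n : ℂ) + 1) * ((n + 1).factorial : ℂ)))) := by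
  have hp := aux_sqrt_pi_ne
  have s1 := (aux_series (z ^ 2 / 4) (-(1 / 2)) (by norm_num) (by norm_num)).2
  have s2 := ((aux_series (z ^ 2 / 4) (1 / 2) (by norm_num) (by norm_num)).2).mul_left (z / 2)
  have s3 := (aux_sum z).mul_left (-(√Real.pi : ℂ)⁻¹)
  refine HasSum.unique (HasSum.even_add_odd ?_ ?_) s3
  · convert! s1 using 1
    funext k
    rw [show (-(1 / 2) : ℂ) + k + 1 = k + 1 / 2 by ring, (aux_deriv k).deriv,
      show (2 * k + 1) / 2 = k by omega]
    linear_combination auxC k * aux_t1 z k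
  · convert! s2 using 1
    funext k
    rw [show ((1 / 2) : ℂ) + k + 1 = (k + 1 : ℕ) + 1 / 2 by push_cast; ring,
      (aux_deriv (k + 1)).deriv, show (2 * k + 1 + 1) / 2 = k + 1 by omega]
    have h := aux_t2 z hz k
    have h' : z / 2 * (2 / z) = 1 := by field_simp
    linear_combination z / 2 * auxC (k + 1) * h +
      auxC (k + 1) * (√Real.pi : ℂ)⁻¹ * (z ^ (2 * k + 1) / ((2 * k + 1).factorial : ℂ)) * h'

lemma aux_I (z ν : ℂ) (hz : z ≠ 0) (hν : -(3 / 4) < ν.re) (hν1 : ‖ν‖ < 1) :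
    HasDerivAt (fun ν => besselI ν z) ((z / 2) ^ ν * Complex.log (z / 2) * auxF (z ^ 2 / 4) ν +
      (z / 2) ^ ν * deriv (auxF (z ^ 2 / 4)) ν) ν := by
  have h1 := (aux_series (z ^ 2 / 4) ν hν hν1).1.hasDerivAt
  have h2 : HasDerivAt (fun ν : ℂ => (z / 2) ^ ν) ((z / 2) ^ ν * Complex.log (z / 2)) ν := by
    simpa using (hasDerivAt_id ν).const_cpow (c := z / 2) (Or.inl (by simpa using hz))
  exact h2.mul h1

lemma aux_K_symm (z ν : ℂ) : besselK (-ν) z = besselK ν z := by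
  simp only [besselK, neg_neg, neg_mul, Complex.sin_neg, div_neg]
  ring

lemma aux_main (z : ℂ) (hz : z ∈ Complex.slitPlane) :
    deriv (fun ν : ℂ => besselK ν z) (1 / 2) =
      ((Real.pi : ℂ) / (2 * z)) ^ ((1 : ℂ) / 2) * expIntE1 (2 * z) * Complex.exp z := by
  have hz0 : z ≠ 0 := Complex.slitPlane_ne_zero hz
  have hp := aux_sqrt_pi_ne
  have i1 := aux_I z (1 / 2) hz0 (by norm_num) (by norm_num)
  have i2 := aux_I z (-(1 / 2)) hz0 (by norm_num) (by norm_num)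
  have i3 := HasDerivAt.comp (1 / 2 : ℂ) i2 (hasDerivAt_neg (1 / 2 : ℂ))
  have hs : HasDerivAt (fun ν : ℂ => Complex.sin (ν * Real.pi)) 0 (1 / 2) := by
    have := ((hasDerivAt_id (1 / 2 : ℂ)).mul_const (Real.pi : ℂ)).csin
    refine this.congr_deriv ?_
    simp only [id]
    rw [show (1 / 2 : ℂ) * Real.pi = Real.pi / 2 by ring, Complex.cos_pi_div_two, zero_mul]
  have hs1 : Complex.sin ((1 / 2 : ℂ) * Real.pi) = 1 := by
    rw [show (1 / 2 : ℂ) * Real.pi = Real.pi / 2 by ring, Complex.sin_pi_div_two]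
  have hK := ((i3.sub i1).const_mul ((Real.pi : ℂ) / 2)).div hs (by rw [hs1]; exact one_ne_zero)
  refine hK.deriv.trans ?_
  rw [hs1]
  have l2 : Complex.log (2 * z) = Complex.log 2 + Complex.log z := by
    have := Complex.log_ofReal_mul (r := 2) (by norm_num) hz0
    simpa [Complex.ofReal_log] using this
  have l3 : Complex.log (z / 2) = Complex.log z - Complex.log 2 := by
    have := Complex.log_ofReal_mul (r := 2) (by norm_num) (x := z / 2) (by simpa using hz0)
    rw [show (((2 : ℝ) : ℂ)) * (z / 2) = z by push_cast; ring, Complex.ofReal_log (by norm_num)]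
      at this
    rw [this]; push_cast; ring
  set A := (z / 2) ^ (-(1 / 2) : ℂ) with hA
  have hz2 : z / 2 ≠ 0 := by simpa using hz0
  have hA2 : (z / 2) ^ (1 / 2 : ℂ) = A * (z / 2) := by
    rw [hA, show (1 / 2 : ℂ) = -(1 / 2) + 1 by norm_num, Complex.cpow_add _ _ hz2,
      Complex.cpow_one]
    norm_num
  have hsq : (√Real.pi : ℂ) * (√Real.pi : ℂ) = Real.pi := by
    rw [← Complex.ofReal_mul, Real.mul_self_sqrt Real.pi_pos.le]
  have hsqe : (√Real.pi : ℂ) = Complex.exp (Real.log Real.pi / 2) := by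
    rw [Real.sqrt_eq_rpow, Real.rpow_def_of_pos Real.pi_pos]
    push_cast; congr 1; ring
  have hP : ((Real.pi : ℂ) / (2 * z)) ^ ((1 : ℂ) / 2) = (√Real.pi : ℂ) / 2 * A := by
    have h2 : (2 : ℂ) = Complex.exp (Complex.log 2) := (Complex.exp_log two_ne_zero).symm
    have hpi : (Real.pi : ℂ) ≠ 0 := by exact_mod_cast Real.pi_ne_zero
    have l4 : Complex.log ((Real.pi : ℂ) / (2 * z)) =
        Real.log Real.pi - (Complex.log 2 + Complex.log z) := by
      have hsl : (2 * z) ∈ Complex.slitPlane := by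
        rw [Complex.mem_slitPlane_iff] at hz ⊢
        simpa using hz
      rw [div_eq_mul_inv, Complex.log_ofReal_mul Real.pi_pos (inv_ne_zero (by simpa using hz0)),
        Complex.log_inv _ (Complex.slitPlane_arg_ne_pi hsl), l2]
      ring
    rw [Complex.cpow_def_of_ne_zero (div_ne_zero hpi (by simpa using hz0)), l4, hA,
      Complex.cpow_def_of_ne_zero hz2, l3, hsqe]
    rw [show Complex.exp (Real.log Real.pi / 2) / 2 =
      Complex.exp (Real.log Real.pi / 2) / Complex.exp (Complex.log 2) by rw [← h2],
      ← Complex.exp_sub, ← Complex.exp_add]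
    congr 1; ring
  rw [hP, hA2, aux_F1, aux_F2 z hz0, l3, expIntE1, l2]
  have hF := aux_F12' z hz0
  have hcs := Complex.cosh_add_sinh z
  set T := ∑' n : ℕ, (-1) ^ (n + 1) * (2 * z) ^ (n + 1) /
        (((n : ℂ) + 1) * ((n + 1).factorial : ℂ))
  set D1 := deriv (auxF (z ^ 2 / 4)) (-(1 / 2))
  set D2 := deriv (auxF (z ^ 2 / 4)) (1 / 2)
  have hD : D1 = -(√Real.pi : ℂ)⁻¹ * (Complex.exp z *
     (-(Real.eulerMascheroniConstant : ℂ) - 2 * Complex.log 2 - T)) - z / 2 * D2 := by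
    linear_combination hF
  rw [hD, ← hcs, ← hsq]
  field_simp
  ring

theorem stmt10 (z : ℂ) (hz : z ∉ Complex.ofReal '' Set.Iic (0 : ℝ)) :
    deriv (fun ν : ℂ => besselK ν z) (1 / 2) =
      ((Real.pi : ℂ) / (2 * z)) ^ ((1 : ℂ) / 2) * expIntE1 (2 * z) * Complex.exp z ∧
    deriv (fun ν : ℂ => besselK ν z) (-(1 / 2)) =
      -(((Real.pi : ℂ) / (2 * z)) ^ ((1 : ℂ) / 2) * expIntE1 (2 * z) * Complex.exp z) := by
  have hs : z ∈ Complex.slitPlane := by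
    rw [Complex.mem_slitPlane_iff]
    by_contra! h
    exact hz ⟨z.re, h.1, Complex.ext (by simp) (by simp [h.2])⟩
  have h := aux_main z hs
  refine ⟨h, ?_⟩
  have h2 := deriv_comp_neg (fun ν : ℂ => besselK ν z) (1 / 2)
  simp only [aux_K_symm] at h2
  rw [← h, h2, neg_neg]
end

section
/- For every z ∈ ℂ with z ≠ 0 and every t ∈ ℂ, (1/z)·cos((z² − 2zt)^{1/2}) = ∑_{n=0}^∞ (t^n/n!) · j_{n−1}(z), where the power 1/2 denotes the principal complex square root (the value of cos of a square root is independent of the choice of sign). -/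
open Complex

/-- The Rayleigh operator `D`, sending `h` to `z ↦ −h′(z)/z`. -/
noncomputable def rayleighD (h : ℂ → ℂ) : ℂ → ℂ := fun z => -deriv h z / z

/-- The spherical Bessel function of the first kind,
via Rayleigh's formula `j_n(z) = zⁿ (Dⁿ (sin w / w))(z)`. -/
noncomputable def sphj (n : ℕ) (z : ℂ) : ℂ :=
  z ^ n * (rayleighD^[n] (fun w => Complex.sin w / w)) z

/-- `j_{n−1}(z)` for `n : ℕ`, where `j_{−1}(z) = cos z / z`. -/
noncomputable def sphjPred (n : ℕ) (z : ℂ) : ℂ :=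
  match n with
  | 0 => Complex.cos z / z
  | m + 1 => sphj m z

/-- cos of the principal square root. -/
noncomputable def cosSqrt (w : ℂ) : ℂ := Complex.cos (w ^ ((1 : ℂ) / 2))

lemma cos_eq_of_sq {a b : ℂ} (h : a ^ 2 = b ^ 2) : Complex.cos a = Complex.cos b := by
  rcases sq_eq_sq_iff_eq_or_eq_neg.mp h with h | h
  · rw [h]
  · rw [h, Complex.cos_neg]

lemma half_sq (w : ℂ) : (w ^ ((1 : ℂ) / 2)) ^ 2 = w := by
  have := Complex.cpow_nat_inv_pow w (n := 2) two_ne_zero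
  simpa using this

lemma cosSqrt_sq (z : ℂ) : cosSqrt (z ^ 2) = Complex.cos z :=
  cos_eq_of_sq (half_sq _)

lemma cosSqrt_diff_ne {w : ℂ} (hw : w ≠ 0) : DifferentiableAt ℂ cosSqrt w := by
  by_cases h : w ∈ slitPlane
  · unfold cosSqrt
    exact (differentiableAt_id.cpow_const h).ccos
  · have h' : -w ∈ slitPlane := by
      rw [Complex.mem_slitPlane_iff] at h ⊢
      push Not at h
      left
      have : w.re ≠ 0 := fun h0 => hw (Complex.ext h0 h.2)
      have := lt_of_le_of_ne h.1 this
      simpa using this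
    have e : cosSqrt = fun w => Complex.cos (I * (-w) ^ ((1 : ℂ) / 2)) := by
      funext w
      apply cos_eq_of_sq
      rw [mul_pow, half_sq, half_sq]
      simp
    rw [e]
    exact ((differentiableAt_id.neg.cpow_const h').const_mul I).ccos

lemma cosSqrt_diff : Differentiable ℂ cosSqrt := by
  intro w
  by_cases hw : w = 0
  · subst hw
    refine (Complex.analyticAt_of_differentiable_on_punctured_nhds_of_continuousAt ?_ ?_).differentiableAt
    · filter_upwards [self_mem_nhdsWithin] with x hx
      exact cosSqrt_diff_ne hx
    · unfold cosSqrt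
      refine Complex.continuous_cos.continuousAt.comp ?_
      exact Complex.continuousAt_cpow_const_of_re_pos (by simp) (by norm_num)
  · exact cosSqrt_diff_ne hw

lemma deriv_iter_sq (n : ℕ) (z : ℂ) :
    HasDerivAt (fun w => iteratedDeriv n cosSqrt (w ^ 2))
      (iteratedDeriv (n + 1) cosSqrt (z ^ 2) * (2 * z)) z := by
  have h1 : DifferentiableAt ℂ (iteratedDeriv n cosSqrt) (z ^ 2) :=
    (cosSqrt_diff.contDiff (n := ((n + 1 : ℕ) : WithTop ℕ∞))).differentiable_iteratedDeriv n
      (by exact_mod_cast Nat.lt_succ_self n) _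
  have h2 := h1.hasDerivAt
  rw [← iteratedDeriv_succ] at h2
  have h3 : HasDerivAt (fun w : ℂ => w ^ 2) (2 * z) z := by
    simpa using hasDerivAt_pow 2 z
  exact h2.comp z h3

lemma rayleigh_iter (n : ℕ) : ∀ z : ℂ, z ≠ 0 →
    (rayleighD^[n] (fun w => Complex.sin w / w)) z =
      (-2) ^ (n + 1) * iteratedDeriv (n + 1) cosSqrt (z ^ 2) := by
  induction n with
  | zero =>
    intro z hz
    have h := deriv_iter_sq 0 z
    simp only [iteratedDeriv_zero, cosSqrt_sq] at h
    have := h.unique (Complex.hasDerivAt_cos z)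
    simp only [Function.iterate_zero, id]
    rw [div_eq_iff hz]
    linear_combination this
  | succ n ih =>
    intro z hz
    rw [Function.iterate_succ_apply']
    have he : (rayleighD^[n] (fun w => Complex.sin w / w)) =ᶠ[nhds z]
        fun w => (-2) ^ (n + 1) * iteratedDeriv (n + 1) cosSqrt (w ^ 2) := by
      filter_upwards [isOpen_ne.mem_nhds hz] with w hw
      exact ih w hw
    rw [rayleighD, he.deriv_eq, ((deriv_iter_sq (n + 1) z).const_mul _).deriv, div_eq_iff hz]
    ring

theorem stmt11 (z : ℂ) (hz : z ≠ 0) (t : ℂ) :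
    HasSum (fun n : ℕ => t ^ n / (n.factorial : ℂ) * sphjPred n z)
      ((1 / z) * Complex.cos ((z ^ 2 - 2 * z * t) ^ ((1 : ℂ) / 2))) := by
  have h := (Complex.hasSum_taylorSeries_of_entire cosSqrt_diff (z ^ 2)
    (z ^ 2 - 2 * z * t)).mul_left (1 / z)
  refine Eq.mp (congrArg (fun f : ℕ → ℂ => HasSum f _) (funext fun n => ?_)) h
  symm
  cases n with
  | zero => simp [sphjPred, cosSqrt_sq]; field_simp
  | succ n =>
    simp only [sphjPred, sphj, rayleigh_iter n z hz, smul_eq_mul]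
    have : z ^ 2 - 2 * z * t - z ^ 2 = (-2) * z * t := by ring
    rw [this, mul_pow, mul_pow]
    field_simp
    ring
end
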